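/- arXiv:2602.19311 — 13 statements merged into one kernel-verified Lean document; each statement's English description precedes it below -/
import Mathlib

section
/- Let n ≥ 1 and let X ⊆ ℝⁿ be a compact, connected set. Suppose there exists a Borel probability measure μ on X such that the function x ↦ ∫_X ‖x − y‖ dμ(y) is constant on X (where ‖·‖ is the Euclidean norm). Then either X is a line segment (X = [a,b] := {(1−t)a + tb : t ∈ [0,1]} for some a, b ∈ ℝⁿ), or X contains no three pairwise distinct collinear points. -/
open MeasureTheory

lemma aux_sameRay {E : Type*} [NormedAddCommGroup E] [InnerProductSpace ℝ E]
    [MeasurableSpace E] (μ : Measure E)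
    (hint : ∀ x : E, Integrable (fun y => ‖x - y‖) μ) (a v : E) (s t r : ℝ)
    (hst : s < t) (htr : t < r)
    (h1 : ∫ y, ‖a + s • v - y‖ ∂μ = ∫ y, ‖a + t • v - y‖ ∂μ)
    (h2 : ∫ y, ‖a + r • v - y‖ ∂μ = ∫ y, ‖a + t • v - y‖ ∂μ) :
    ∀ᵐ y ∂μ, SameRay ℝ (a + s • v - y) (a + r • v - y) := by
  have hv : ∀ y, (r - s) • (a + t • v - y)
      = (r - t) • (a + s • v - y) + (t - s) • (a + r • v - y) := by
    intro y; module
  have hn : ∀ y, (r - s) * ‖a + t • v - y‖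
      = ‖(r - t) • (a + s • v - y) + (t - s) • (a + r • v - y)‖ := by
    intro y
    rw [← hv, norm_smul, Real.norm_of_nonneg (by linarith)]
  have hn1 : ∀ y, ‖(r - t) • (a + s • v - y)‖ = (r - t) * ‖a + s • v - y‖ := by
    intro y; rw [norm_smul, Real.norm_of_nonneg (by linarith)]
  have hn2 : ∀ y, ‖(t - s) • (a + r • v - y)‖ = (t - s) * ‖a + r • v - y‖ := by
    intro y; rw [norm_smul, Real.norm_of_nonneg (by linarith)]
  have hz : ∫ y, ((r - t) * ‖a + s • v - y‖ + (t - s) * ‖a + r • v - y‖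
      - (r - s) * ‖a + t • v - y‖) ∂μ = 0 := by
    have hi : Integrable (fun y => (r - t) * ‖a + s • v - y‖ + (t - s) * ‖a + r • v - y‖) μ :=
      ((hint _).const_mul _).add ((hint _).const_mul _)
    rw [integral_sub hi ((hint _).const_mul _),
      integral_add ((hint _).const_mul _) ((hint _).const_mul _)]
    simp only [integral_const_mul]
    rw [h1, h2]; ring
  rw [integral_eq_zero_iff_of_nonneg] at hz
  · filter_upwards [hz] with y hy
    have : SameRay ℝ ((r - t) • (a + s • v - y)) ((t - s) • (a + r • v - y)) := by
      rw [sameRay_iff_norm_add, ← hn, hn1, hn2]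
      simp only [Pi.zero_apply] at hy
      linarith
    have h3 := (this.pos_smul_left (inv_pos.2 (sub_pos.2 htr))).pos_smul_right
      (inv_pos.2 (sub_pos.2 hst))
    rwa [inv_smul_smul₀ (by linarith), inv_smul_smul₀ (by linarith)] at h3
  · intro y
    simp only [Pi.zero_apply]
    have := norm_add_le ((r - t) • (a + s • v - y)) ((t - s) • (a + r • v - y))
    rw [← hn, hn1, hn2] at this
    linarith
  · exact (((hint _).const_mul _).add ((hint _).const_mul _)).sub ((hint _).const_mul _)

lemma aux_seg {E : Type*} [NormedAddCommGroup E] [InnerProductSpace ℝ E]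
    (X : Set E) (hX : IsPreconnected X) (p q : E) (hp : p ∈ X) (hq : q ∈ X)
    (h : X ⊆ segment ℝ p q) : X = segment ℝ p q := by
  apply Set.Subset.antisymm h
  intro z hz
  by_cases hpq : p = q
  · subst hpq
    simp at hz
    rwa [hz]
  rw [segment_eq_image'] at hz h
  obtain ⟨t, ht, rfl⟩ := hz
  have hc : ContinuousOn (fun x : E => inner ℝ (q - p) (x - p)) X := by fun_prop
  have hpos : 0 < inner ℝ (q - p) (q - p) := by
    rw [real_inner_self_eq_norm_sq]
    have : q - p ≠ 0 := sub_ne_zero.2 (Ne.symm hpq)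
    positivity
  have := hX.intermediate_value hp hq hc
  have hm : t * inner ℝ (q - p) (q - p) ∈ Set.Icc (inner ℝ (q - p) (p - p)) (inner ℝ (q - p) (q - p)) := by
    constructor
    · simp only [sub_self, inner_zero_right]; exact mul_nonneg ht.1 hpos.le
    · nlinarith [ht.2]
  obtain ⟨x, hx, hxe⟩ := this hm
  obtain ⟨s, hs, rfl⟩ := h hx
  simp only [add_sub_cancel_left, inner_smul_right] at hxe
  have : s = t := mul_right_cancel₀ hpos.ne' hxe
  subst this
  exact hx

lemma aux_main {E : Type*} [NormedAddCommGroup E] [InnerProductSpace ℝ E]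
    [MeasurableSpace E] (μ : Measure E) [IsProbabilityMeasure μ]
    (hint : ∀ x : E, Integrable (fun y => ‖x - y‖) μ)
    (X : Set E) (hXc : IsCompact X) (hX : IsPreconnected X) (hae : ∀ᵐ y ∂μ, y ∈ X)
    (C : ℝ) (hC : ∀ x ∈ X, ∫ y, ‖x - y‖ ∂μ = C)
    (a b c : E) (ha : a ∈ X) (hb : b ∈ X) (hc : c ∈ X) (hab : a ≠ b) (hbc : b ≠ c)
    (hac : a ≠ c) (hw : Wbtw ℝ a b c) : ∃ p q : E, X = segment ℝ p q := by
  obtain ⟨t, ⟨ht0, ht1⟩, rfl⟩ := hw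
  set v := c - a with hv
  have hv0 : v ≠ 0 := sub_ne_zero.2 hac.symm
  have hlm : AffineMap.lineMap a c t = a + t • v := by
    rw [AffineMap.lineMap_apply]; simp [hv, add_comm]
  rw [hlm] at hb hab hbc
  have hc1 : c = a + (1:ℝ) • v := by simp [hv]
  have ha0 : a = a + (0:ℝ) • v := by simp
  have ht0' : 0 < t := lt_of_le_of_ne ht0 (by rintro rfl; simp at hab)
  have ht1' : t < 1 := lt_of_le_of_ne ht1 (by rintro rfl; exact hbc hc1.symm)
  have hX0 : a + (0:ℝ) • v ∈ X := by rwa [← ha0]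
  have hX1 : a + (1:ℝ) • v ∈ X := by rwa [← hc1]
  have hray1 := aux_sameRay μ hint a v 0 t 1 ht0' ht1' (by rw [hC _ hX0, hC _ hb])
    (by rw [hC _ hX1, hC _ hb])
  set S : Set ℝ := (fun s : ℝ => a + s • v) ⁻¹' X with hS
  have hSc : IsCompact S :=
    ((Homeomorph.addLeft a).isClosedEmbedding.comp
      (isClosedEmbedding_smul_left hv0)).isCompact_preimage hXc
  obtain ⟨s0, hs0, hmin⟩ := hSc.exists_isLeast ⟨0, hX0⟩
  obtain ⟨s1, hs1, hmax⟩ := hSc.exists_isGreatest ⟨0, hX0⟩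
  have h00 : s0 ≤ 0 := hmin hX0
  have h11 : 1 ≤ s1 := hmax hX1
  have hray2 := aux_sameRay μ hint a v s0 t s1 (by linarith) (by linarith)
    (by rw [hC _ hs0, hC _ hb]) (by rw [hC _ hs1, hC _ hb])
  set p := a + s0 • v with hp
  set q := a + s1 • v with hq
  have hpX : p ∈ X := hs0
  have hqX : q ∈ X := hs1
  have hvn : 0 < ‖v‖ := norm_pos_iff.2 hv0
  have hpq : ∀ᵐ y ∂μ, y = p ∨ y = q := by
    filter_upwards [hae, hray1, hray2] with y hy h1 h2
    obtain ⟨α, β, -, -, hαβ, e1, e2⟩ := h1.exists_eq_smul_add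
    set u := a + (0:ℝ) • v - y + (a + (1:ℝ) • v - y)
    have e3 : v = (β - α) • u := by
      rw [sub_smul, ← e1, ← e2]; module
    have hne : β - α ≠ 0 := by
      intro h; rw [h, zero_smul] at e3; exact hv0 e3
    have hyr : y = a + (-(α / (β - α))) • v := by
      have : a + (-(α / (β - α))) • v = a - α • u := by
        conv_lhs => rw [e3]
        rw [smul_smul, neg_mul, div_mul_cancel₀ _ hne, neg_smul, sub_eq_add_neg]
      rw [this, ← e1]; module
    generalize -(α / (β - α)) = r at hyr
    have hrS : r ∈ S := by
      change a + r • v ∈ X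
      rwa [← hyr]
    have hr0 := hmin hrS
    have hr1 := hmax hrS
    rw [sameRay_iff_norm_add] at h2
    have f1 : p - y = (s0 - r) • v := by rw [hyr, hp]; module
    have f2 : q - y = (s1 - r) • v := by rw [hyr, hq]; module
    rw [f1, f2, ← add_smul, norm_smul, norm_smul, norm_smul, ← add_mul] at h2
    have h3 := mul_right_cancel₀ hvn.ne' h2
    simp only [Real.norm_eq_abs] at h3
    rw [abs_of_nonpos (by linarith : s0 - r ≤ 0), abs_of_nonneg (by linarith : 0 ≤ s1 - r)] at h3
    rcases abs_cases (s0 - r + (s1 - r)) with ⟨h4, _⟩ | ⟨h4, _⟩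
    · left; rw [hyr, hp, show r = s0 by linarith]
    · right; rw [hyr, hq, show r = s1 by linarith]
  have hD : 0 < ‖p - q‖ := by
    have : p - q = (s0 - s1) • v := by rw [hp, hq]; module
    rw [this]
    exact norm_pos_iff.2 (smul_ne_zero (by linarith) hv0)
  have hsum : C + C = ‖p - q‖ := by
    conv_lhs => rw [← hC p hpX]
    rw [hC p hpX]
    nth_rewrite 1 [← hC p hpX]
    rw [← hC q hqX, ← integral_add (hint _) (hint _)]
    have : (fun y => ‖p - y‖ + ‖q - y‖) =ᵐ[μ] fun _ => ‖p - q‖ := by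
      filter_upwards [hpq] with y hy
      rcases hy with rfl | rfl
      · simp [norm_sub_rev]
      · simp
    rw [integral_congr_ae this]; simp
  refine ⟨p, q, aux_seg X hX p q hpX hqX ?_⟩
  intro x hx
  have hid : C * ‖p - q‖ = ‖x - p‖ * C + ‖x - q‖ * C := by
    nth_rewrite 3 [← hC p hpX]
    nth_rewrite 2 [← hC q hqX]
    rw [← hC x hx, ← integral_const_mul, ← integral_const_mul, ← integral_mul_const,
      ← integral_add ((hint _).const_mul _) ((hint _).const_mul _)]
    apply integral_congr_ae
    filter_upwards [hpq] with y hy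
    rcases hy with rfl | rfl
    · simp [norm_sub_rev]
    · simp
  have hC0 : 0 < C := by linarith
  have hfin : ‖x - p‖ + ‖x - q‖ = ‖p - q‖ := by
    apply mul_right_cancel₀ hC0.ne'
    linarith
  rw [mem_segment_iff_wbtw, ← dist_add_dist_eq_iff, dist_eq_norm, dist_eq_norm, dist_eq_norm,
    norm_sub_rev p x]
  exact hfin

/-- **Proposition 1 (Wilson).** If a compact connected set `X ⊆ ℝⁿ` carries a Borel
probability measure `μ` for which `x ↦ ∫_X ‖x - y‖ dμ(y)` is constant on `X`, then `X`
is a line segment or contains no three pairwise distinct collinear points. -/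
theorem stmt_0 (n : ℕ) (hn : 1 ≤ n) (X : Set (EuclideanSpace ℝ (Fin n)))
    (hXc : IsCompact X) (hXconn : IsConnected X)
    (μ : Measure (EuclideanSpace ℝ (Fin n))) (hμ : IsProbabilityMeasure μ)
    (hsupp : μ Xᶜ = 0)
    (hconst : ∃ c : ℝ, ∀ x ∈ X, ∫ y in X, ‖x - y‖ ∂μ = c) :
    (∃ a b : EuclideanSpace ℝ (Fin n), X = segment ℝ a b) ∨
      (∀ a ∈ X, ∀ b ∈ X, ∀ c ∈ X, a ≠ b → b ≠ c → a ≠ c →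
        ¬ Collinear ℝ ({a, b, c} : Set (EuclideanSpace ℝ (Fin n)))) := by
  have hae : ∀ᵐ y ∂μ, y ∈ X := by
    rw [ae_iff]; exact hsupp
  rw [Measure.restrict_eq_self_of_ae_mem hae] at hconst
  obtain ⟨C, hC⟩ := hconst
  have hint : ∀ x : EuclideanSpace ℝ (Fin n), Integrable (fun y => ‖x - y‖) μ := by
    intro x
    have h : IntegrableOn (fun y => ‖x - y‖) X μ :=
      ContinuousOn.integrableOn_compact hXc (by fun_prop)
    rwa [IntegrableOn, Measure.restrict_eq_self_of_ae_mem hae] at h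
  by_cases H : ∀ a ∈ X, ∀ b ∈ X, ∀ c ∈ X, a ≠ b → b ≠ c → a ≠ c →
        ¬ Collinear ℝ ({a, b, c} : Set (EuclideanSpace ℝ (Fin n)))
  · exact Or.inr H
  left
  push Not at H
  obtain ⟨a, ha, b, hb, c, hc, hab, hbc, hac, hcol⟩ := H
  rcases hcol.wbtw_or_wbtw_or_wbtw with h | h | h
  · exact aux_main μ hint X hXc hXconn.isPreconnected hae C hC a b c ha hb hc hab hbc hac h
  · exact aux_main μ hint X hXc hXconn.isPreconnected hae C hC b c a hb hc ha hbc hac.symm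
      hab.symm h
  · exact aux_main μ hint X hXc hXconn.isPreconnected hae C hC c a b hc ha hb hac.symm hab
      hbc.symm h
end

section
/- There exists a universal constant ε₀ > 0 with the following property. Let γ : ℝ → ℝ² be a smooth closed strictly convex curve of length L (γ is C^∞, L-periodic, unit speed, injective on [0, L), with signed curvature κ(s) = γ₁'(s)γ₂''(s) − γ₂'(s)γ₁''(s) > 0 for all s), with image X = γ(ℝ). If 1 − ε₀ ≤ (L/(2π))·κ(s) ≤ 1 + ε₀ for all s, then there exists a Borel probability measure μ on X such that x ↦ ∫_X ‖x − y‖ dμ(y) is constant on X. -/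
open MeasureTheory Real

lemma aux_sin {θ : ℝ} (h0 : 0 ≤ θ) (h1 : θ ≤ 2 * π / 3) : θ / 10 ≤ sin θ := by
  have hpi := Real.pi_gt_three
  have hpi' := Real.pi_lt_four
  rcases le_total θ (π / 2) with h | h
  · have := Real.mul_le_sin h0 h
    have h2 : 1 / 10 ≤ 2 / π := by
      rw [div_le_div_iff₀ (by norm_num) (by positivity)]; linarith
    nlinarith
  · have := Real.mul_le_sin (x := π - θ) (by linarith) (by linarith)
    rw [Real.sin_pi_sub] at this
    have h3 : 2 / π * (π / 3) ≤ 2 / π * (π - θ) := by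
      apply mul_le_mul_of_nonneg_left _ (by positivity); linarith
    have h4 : 2 / π * (π / 3) = 2 / 3 := by field_simp
    linarith

lemma aux_cos {θ : ℝ} (h0 : 2 * π / 3 ≤ θ) (h1 : θ ≤ π) : cos θ ≤ -1 / 2 := by
  have hpi := Real.pi_gt_three
  have h := Real.cos_le_cos_of_nonneg_of_le_pi (by positivity) h1 h0
  have : cos (2 * π / 3) = -1 / 2 := by
    rw [show 2 * π / 3 = π - π / 3 by ring, Real.cos_pi_sub, Real.cos_pi_div_three]; ring
  linarith

lemma aux_ode {k e : ℝ} (hk : 0 < k) (p h κ : ℝ → ℝ)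
    (hp : ∀ x, HasDerivAt p (1 - κ x * h x) x) (hh : ∀ x, HasDerivAt h (κ x * p x) x)
    (p0 : p 0 = 0) (h0 : h 0 = 0) (hr : ∀ x, p x ^ 2 + h x ^ 2 ≤ x ^ 2)
    (hκ : ∀ x, |κ x - k| ≤ e) {x : ℝ} (hx : 0 ≤ x) :
    |p x - sin (k * x) / k| ≤ e * x * x ∧ |h x - (1 - cos (k * x)) / k| ≤ e * x * x := by
  have he : 0 ≤ e := (abs_nonneg _).trans (hκ 0)
  -- rotated difference
  let A : ℝ → ℝ := fun s => p s - sin (k * s) / k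
  let B : ℝ → ℝ := fun s => h s - (1 - cos (k * s)) / k
  let D : ℝ → ℂ := fun s => ((A s : ℂ) + (B s : ℂ) * Complex.I) * Complex.exp (-(k * s : ℝ) * Complex.I)
  have hA : ∀ s, HasDerivAt A (1 - κ s * h s - cos (k * s)) s := by
    intro s
    have h1 : HasDerivAt (fun s => k * s) k s := by simpa using (hasDerivAt_id s).const_mul k
    have := (hp s).sub ((h1.sin).div_const k)
    refine this.congr_deriv ?_
    rw [mul_div_assoc, div_self hk.ne', mul_one]
  have hB : ∀ s, HasDerivAt B (κ s * p s - sin (k * s)) s := by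
    intro s
    have h1 : HasDerivAt (fun s => k * s) k s := by simpa using (hasDerivAt_id s).const_mul k
    have := (hh s).sub (((h1.cos).const_sub 1).div_const k)
    refine this.congr_deriv ?_
    field_simp
  have hD : ∀ s, HasDerivAt D (((κ s - k : ℝ) : ℂ) * Complex.I * ((p s : ℂ) + h s * Complex.I) * Complex.exp (-(k * s : ℝ) * Complex.I)) s := by
    intro s
    have h1 : HasDerivAt (fun s : ℝ => (-(k * s : ℝ) * Complex.I : ℂ)) (-k * Complex.I) s := by
      have : HasDerivAt (fun s : ℝ => k * s) k s := by simpa using (hasDerivAt_id s).const_mul k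
      exact (this.ofReal_comp.neg).mul_const _
    have h2 := (((hA s).ofReal_comp.add ((hB s).ofReal_comp.mul_const Complex.I)).mul h1.cexp)
    refine h2.congr_deriv ?_
    have hk' : (k : ℂ) ≠ 0 := by exact_mod_cast hk.ne'
    have hI := Complex.I_sq
    simp only [A, B, Pi.add_apply]
    push_cast
    field_simp
    ring_nf
    simp only [hI]
    ring_nf
  have hbd : ‖D x - D 0‖ ≤ (e * x) * ‖x - 0‖ := by
    apply (convex_Icc (0:ℝ) x).norm_image_sub_le_of_norm_hasDerivWithin_le
      (fun s _ => (hD s).hasDerivWithinAt) _ ⟨le_rfl, hx⟩ ⟨hx, le_rfl⟩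
    intro s hs
    have hn : ‖(p s : ℂ) + h s * Complex.I‖ ≤ x := by
      rw [Complex.norm_add_mul_I]
      apply Real.sqrt_le_iff.2 ⟨hx, ?_⟩
      have := hr s
      nlinarith [hs.1, hs.2]
    have hexp : ‖Complex.exp (-(k * s : ℝ) * Complex.I)‖ = 1 := by
      have := Complex.norm_exp_ofReal_mul_I (-(k*s))
      simpa using this
    rw [norm_mul, norm_mul, norm_mul, hexp, Complex.norm_real, Complex.norm_I, Real.norm_eq_abs]
    have := hκ s
    have h3 := norm_nonneg ((p s : ℂ) + h s * Complex.I)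
    nlinarith [mul_le_mul this hn h3 he]
  have hD0 : D 0 = 0 := by simp [D, A, B, p0, h0]
  have hDx : ‖D x‖ = ‖(A x : ℂ) + (B x : ℂ) * Complex.I‖ := by
    have hexp : ‖Complex.exp (-(k * x : ℝ) * Complex.I)‖ = 1 := by
      have := Complex.norm_exp_ofReal_mul_I (-(k*x))
      simpa using this
    simp only [D]
    rw [norm_mul, hexp, mul_one]
  rw [hD0, sub_zero, sub_zero, hDx, Real.norm_of_nonneg hx] at hbd
  constructor
  · have := Complex.abs_re_le_norm ((A x : ℂ) + (B x : ℂ) * Complex.I)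
    simp at this
    exact this.trans hbd
  · have := Complex.abs_im_le_norm ((A x : ℂ) + (B x : ℂ) * Complex.I)
    simp at this
    exact this.trans hbd

lemma aux_half {k : ℝ} (hk : 0 < k) (p h κ : ℝ → ℝ)
    (hp : ∀ x, HasDerivAt p (1 - κ x * h x) x) (hh : ∀ x, HasDerivAt h (κ x * p x) x)
    (p0 : p 0 = 0) (h0 : h 0 = 0) (hr : ∀ x, p x ^ 2 + h x ^ 2 ≤ x ^ 2)
    (hκ : ∀ x, |κ x - k| ≤ k / 100) {x : ℝ} (hx : 0 ≤ x) (hx1 : k * x ≤ π) :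
    0 ≤ h x ∧ h x ≤ κ x * (p x ^ 2 + h x ^ 2) := by
  have hpi := Real.pi_gt_three
  have hpi' : π < 3.15 := Real.pi_lt_d2
  have hode := fun {x : ℝ} (hx : 0 ≤ x) => aux_ode hk p h κ hp hh p0 h0 hr hκ hx
  have hκ1 : ∀ x, 0.99 * k ≤ κ x := fun x => by have := abs_le.1 (hκ x); linarith
  have hκ2 : ∀ x, κ x ≤ 1.01 * k := fun x => by have := abs_le.1 (hκ x); linarith
  have hppos : ∀ y, 0 ≤ y → k * y ≤ 2 * π / 3 → 0 ≤ p y := by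
    intro y hy hy1
    have h1 := (abs_le.1 (hode hy).1).1
    have h2 := aux_sin (by positivity) hy1
    have h3 : y / 10 ≤ sin (k * y) / k := by
      rw [le_div_iff₀ hk]; linarith
    have h4 : k / 100 * y * y ≤ y / 10 := by nlinarith
    linarith
  rcases le_total (k * x) (2 * π / 3) with hc | hc
  · have hsub : ∀ y ∈ Set.Icc 0 x, 0 ≤ p y := fun y hy =>
      hppos y hy.1 (by nlinarith [hy.2])
    have hm1 : MonotoneOn h (Set.Icc 0 x) := by
      apply monotoneOn_of_deriv_nonneg (convex_Icc 0 x)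
        (fun y _ => (hh y).continuousAt.continuousWithinAt)
        (fun y _ => (hh y).differentiableAt.differentiableWithinAt)
      intro y hy
      rw [(hh y).deriv]
      have := hsub y (interior_subset hy)
      have := hκ1 y
      have : 0 ≤ κ y := by linarith
      positivity
    have hF : ∀ y, HasDerivAt (fun y => 0.99 * k * (p y ^ 2 + h y ^ 2) - h y)
        (p y * (1.98 * k - κ y)) y := by
      intro y
      have := ((((hp y).pow 2).add ((hh y).pow 2)).const_mul (0.99 * k)).sub (hh y)
      refine this.congr_deriv ?_
      push_cast
      ring
    have hm2 : MonotoneOn (fun y => 0.99 * k * (p y ^ 2 + h y ^ 2) - h y) (Set.Icc 0 x) := by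
      apply monotoneOn_of_deriv_nonneg (convex_Icc 0 x)
        (fun y _ => (hF y).continuousAt.continuousWithinAt)
        (fun y _ => (hF y).differentiableAt.differentiableWithinAt)
      intro y hy
      rw [(hF y).deriv]
      have := hsub y (interior_subset hy)
      have := hκ2 y
      have : 0 ≤ 1.98 * k - κ y := by linarith
      positivity
    have e1 := hm1 ⟨le_rfl, hx⟩ ⟨hx, le_rfl⟩ hx
    have e2 := hm2 ⟨le_rfl, hx⟩ ⟨hx, le_rfl⟩ hx
    simp only [p0, h0] at e1 e2
    refine ⟨e1, ?_⟩
    have : 0.99 * k * (p x ^ 2 + h x ^ 2) ≤ κ x * (p x ^ 2 + h x ^ 2) :=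
      mul_le_mul_of_nonneg_right (hκ1 x) (by positivity)
    nlinarith
  · have h1 := (abs_le.1 (hode hx).2).1
    have h2 := aux_cos hc hx1
    have h3 : 1.5 / k ≤ (1 - cos (k * x)) / k := by
      apply div_le_div_of_nonneg_right _ hk.le; linarith
    have h4 : k / 100 * x * x ≤ 0.1 / k := by
      rw [le_div_iff₀ hk]
      have : k / 100 * x * x * k = (k * x) * (k * x) / 100 := by ring
      rw [this]; nlinarith [mul_nonneg hk.le hx]
    have h5 : 1.4 / k ≤ h x := by
      have : 1.4 / k = 1.5 / k - 0.1 / k := by ring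
      linarith
    have h6 : 0 ≤ h x := le_trans (by positivity) h5
    refine ⟨h6, ?_⟩
    have h7 : 1 ≤ κ x * h x := by
      have : 0.99 * k * (1.4 / k) ≤ κ x * h x :=
        mul_le_mul (hκ1 x) h5 (by positivity) (by linarith [hκ1 x])
      have e : 0.99 * k * (1.4 / k) = 0.99 * 1.4 := by field_simp
      rw [e] at this; norm_num at this ⊢; linarith
    have hkx : 0 ≤ κ x := by linarith [hκ1 x]
    nlinarith [mul_nonneg hkx (sq_nonneg (p x))]

lemma aux_full {k : ℝ} (hk : 0 < k) (p h κ : ℝ → ℝ)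
    (hp : ∀ x, HasDerivAt p (1 - κ x * h x) x) (hh : ∀ x, HasDerivAt h (κ x * p x) x)
    (p0 : p 0 = 0) (h0 : h 0 = 0) (hr : ∀ x, p x ^ 2 + h x ^ 2 ≤ x ^ 2)
    (hκ : ∀ x, |κ x - k| ≤ k / 100) {x : ℝ} (hx1 : k * |x| ≤ π) :
    0 ≤ h x ∧ h x ≤ κ x * (p x ^ 2 + h x ^ 2) := by
  rcases le_total 0 x with hx | hx
  · rw [abs_of_nonneg hx] at hx1
    exact aux_half hk p h κ hp hh p0 h0 hr hκ hx hx1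
  · rw [abs_of_nonpos hx] at hx1
    have hneg : ∀ y : ℝ, HasDerivAt (fun y : ℝ => -y) (-1) y := fun y => by
      exact (hasDerivAt_id' y).neg
    have := aux_half hk (fun y => - p (-y)) (fun y => h (-y)) (fun y => κ (-y))
      (fun y => by
        have := ((hp (-y)).comp y (hneg y)).neg
        refine this.congr_deriv ?_
        ring)
      (fun y => by
        have := ((hh (-y)).comp y (hneg y))
        refine this.congr_deriv ?_
        ring)
      (by simp [p0]) (by simp [h0]) (fun y => by simpa using hr (-y)) (fun y => hκ (-y))
      (x := -x) (by linarith) hx1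
    simpa using this

lemma aux_max (X : Type*) [MetricSpace X] [CompactSpace X] [Nonempty X] [MeasurableSpace X]
    [BorelSpace X] : ∃ μ : Measure X, IsProbabilityMeasure μ ∧ ∃ I : ℝ,
      Continuous (fun x => ∫ y, dist x y ∂μ) ∧ (∀ x, ∫ y, dist x y ∂μ ≤ I) ∧ ∀ᵐ x ∂μ, ∫ y, dist x y ∂μ = I := by
  let d : BoundedContinuousFunction (X × X) ℝ :=
    BoundedContinuousFunction.mkOfCompact ⟨fun q => dist q.1 q.2, by fun_prop⟩
  have hcont : Continuous (fun μ : ProbabilityMeasure X => ∫ q, d q ∂((μ.prod μ : ProbabilityMeasure (X × X)) : Measure (X × X))) := by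
    have h1 : Continuous (fun ν : ProbabilityMeasure (X × X) => ∫ q, d q ∂(ν : Measure (X × X))) := by
      rw [continuous_iff_continuousAt]
      intro ν
      exact (ProbabilityMeasure.tendsto_iff_forall_integral_tendsto.1 Filter.tendsto_id d)
    exact h1.comp (ProbabilityMeasure.continuous_prod.comp (continuous_id.prodMk continuous_id))
  have : Nonempty (ProbabilityMeasure X) :=
    ⟨⟨Measure.dirac (Classical.arbitrary X), inferInstance⟩⟩
  obtain ⟨μ, -, hμ⟩ := isCompact_univ.exists_isMaxOn Set.univ_nonempty hcont.continuousOn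
  have hcd : Continuous fun q : X × X => dist q.1 q.2 := by fun_prop
  have hint1 : ∀ (ν : Measure X) [IsFiniteMeasure ν] (x : X), Integrable (fun y => dist x y) ν :=
    fun ν _ x => (by fun_prop : Continuous fun y => dist x y).integrable_of_hasCompactSupport
      (HasCompactSupport.of_compactSpace _)
  have hint2 : ∀ (ν : Measure (X × X)) [IsFiniteMeasure ν], Integrable (fun q : X × X => dist q.1 q.2) ν :=
    fun ν _ => hcd.integrable_of_hasCompactSupport
      (HasCompactSupport.of_compactSpace _)
  let U : Measure X → X → ℝ := fun ν x => ∫ y, dist x y ∂ν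
  have hU : ∀ (ν : Measure X) [IsProbabilityMeasure ν], Continuous (U ν) := by
    intro ν _
    have : LipschitzWith 1 (U ν) := by
      apply LipschitzWith.of_dist_le_mul
      intro a b
      simp only [U]
      rw [Real.dist_eq, ← integral_sub (hint1 ν a) (hint1 ν b)]
      calc |∫ y, (dist a y - dist b y) ∂ν| ≤ ∫ y, |dist a y - dist b y| ∂ν := abs_integral_le_integral_abs
        _ ≤ ∫ y, dist a b ∂ν := by
          apply integral_mono ((hint1 ν a).sub (hint1 ν b)).abs (integrable_const _)
          intro y
          exact abs_dist_sub_le a b y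
        _ = _ := by simp
    exact this.continuous
  have hUi : ∀ (ν ν' : Measure X) [IsProbabilityMeasure ν] [IsFiniteMeasure ν'], Integrable (U ν) ν' := 
    fun ν ν' _ _ => (hU ν).integrable_of_hasCompactSupport
      (HasCompactSupport.of_compactSpace _)
  have hmax : ∀ (ν : Measure X) [IsProbabilityMeasure ν], ∫ x, U ν x ∂ν ≤ ∫ x, U μ x ∂(μ : Measure X) := by
    intro ν _
    have h := hμ (Set.mem_univ (⟨ν, inferInstance⟩ : ProbabilityMeasure X))
    simp only [ProbabilityMeasure.toMeasure_prod] at h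
    have e : ∀ (ν : Measure X) [IsProbabilityMeasure ν], ∫ q, d q ∂(ν.prod ν) = ∫ x, U ν x ∂ν := by
      intro ν _
      exact integral_prod (μ := ν) (ν := ν) (fun q : X × X => dist q.1 q.2) (hint2 _)
    have e1 := e ν
    have e2 := e (μ : Measure X)
    rw [← e1, ← e2]
    exact h
  set I := ∫ x, U μ x ∂(μ : Measure X) with hI
  have hle : ∀ x, U μ x ≤ I := by
    intro x
    by_contra hlt
    push Not at hlt
    have key : ∀ τ : ℝ, 0 < τ → τ < 1 → (1 - τ) ^ 2 * I + 2 * τ * (1 - τ) * U μ x ≤ I := by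
      intro τ h0 h1
      let ν : Measure X := ENNReal.ofReal (1 - τ) • (μ : Measure X) + ENNReal.ofReal τ • Measure.dirac x
      have hν : IsProbabilityMeasure ν := ⟨by
        simp only [ν, Measure.add_apply, Measure.smul_apply, measure_univ, smul_eq_mul, mul_one]
        rw [← ENNReal.ofReal_add (by linarith) h0.le]; simp⟩
      have fm : ∀ (r : ℝ) (m : Measure X) [IsProbabilityMeasure m], IsFiniteMeasure (ENNReal.ofReal r • m) :=
        fun r m _ => ⟨by simp⟩
      have hi : ∀ f : X → ℝ, Continuous f → ∫ y, f y ∂ν = (1 - τ) * ∫ y, f y ∂(μ : Measure X) + τ * f x := by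
        intro f hf
        have := fm (1 - τ) μ
        have := fm τ (Measure.dirac x)
        have hfi : ∀ (m : Measure X) [IsFiniteMeasure m], Integrable f m := fun m _ =>
          hf.integrable_of_hasCompactSupport (HasCompactSupport.of_compactSpace _)
        simp only [ν]
        rw [integral_add_measure (hfi _) (hfi _), integral_smul_measure, integral_smul_measure,
          integral_dirac, ENNReal.toReal_ofReal (by linarith), ENNReal.toReal_ofReal h0.le]
        simp
      have hUν : ∀ z, U ν z = (1 - τ) * U μ z + τ * dist z x := fun z => hi _ (by fun_prop)
      have h := hmax ν
      rw [hi _ (hU ν)] at h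
      have e3 : ∫ z, U ν z ∂(μ : Measure X) = (1 - τ) * I + τ * U μ x := by
        simp_rw [hUν]
        rw [integral_add ((hUi μ μ).const_mul _) (((hint1 μ x).congr (by simp [dist_comm])).const_mul _),
          integral_const_mul, integral_const_mul]
        simp only [U, dist_comm x, hI]
      rw [e3, hUν x, dist_self] at h
      nlinarith
    -- pick τ small
    have hI0 : 0 ≤ I := integral_nonneg fun z => integral_nonneg fun y => dist_nonneg
    set u := U μ x
    have hu : 0 < u := by linarith
    have := key ((u - I) / (2 * u)) (by apply div_pos <;> linarith)
      (by rw [div_lt_one (by linarith)]; linarith)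
    set τ := (u - I) / (2 * u) with hτ
    have h0 : 0 < τ := by apply div_pos <;> linarith
    have h2 : 2 * u * τ = u - I := by rw [hτ]; field_simp
    have : τ * (2 * (u - I) - τ * (2 * u - I)) ≤ 0 := by nlinarith
    have h3 : 2 * (u - I) - τ * (2 * u - I) ≤ 0 := by
      by_contra hc; push Not at hc
      have := mul_pos h0 hc; linarith
    nlinarith
  refine ⟨μ, inferInstance, I, hU μ, hle, ?_⟩
  have hz : ∫ x, (I - U μ x) ∂(μ : Measure X) = 0 := by
    rw [integral_sub (integrable_const _) (hUi μ μ)]; simp [hI]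
  replace hz := (integral_eq_zero_iff_of_nonneg (f := fun x => I - U μ x) (fun x => by simpa using hle x) ((integrable_const _).sub (hUi μ μ))).1 hz
  filter_upwards [hz] with x hx
  simp only [Pi.zero_apply] at hx
  change U μ x = I
  linarith

lemma aux_conc {L : ℝ} (hL : 0 < L) (γ : ℝ → EuclideanSpace ℝ (Fin 2))
    (hγ : ContDiff ℝ (⊤ : ℕ∞) γ) (hper : Function.Periodic γ L)
    (hunit : ∀ s : ℝ, ‖deriv γ s‖ = 1) (hinj : Set.InjOn γ (Set.Ico 0 L)) (κ : ℝ → ℝ)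
    (hκ : ∀ s : ℝ, κ s =
          deriv (fun t => γ t 0) s * deriv (deriv (fun t => γ t 1)) s -
            deriv (fun t => γ t 1) s * deriv (deriv (fun t => γ t 0)) s)
    (hb : ∀ s : ℝ, 1 - 1 / 100 ≤ L / (2 * π) * κ s ∧ L / (2 * π) * κ s ≤ 1 + 1 / 100) (t : ℝ) :
    ConcaveOn ℝ (Set.Icc t (t + L)) (fun s => ‖γ s - γ t‖) := by
  have hpi := Real.pi_pos
  set x : ℝ → ℝ := fun t => γ t 0 with hx
  set y : ℝ → ℝ := fun t => γ t 1 with hy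
  have hxs : ContDiff ℝ (⊤ : ℕ∞) x := (contDiff_euclidean.1 hγ) 0
  have hys : ContDiff ℝ (⊤ : ℕ∞) y := (contDiff_euclidean.1 hγ) 1
  have hxs' : ContDiff ℝ (⊤ : ℕ∞) (deriv x) := (contDiff_infty_iff_deriv.1 hxs).2
  have hys' : ContDiff ℝ (⊤ : ℕ∞) (deriv y) := (contDiff_infty_iff_deriv.1 hys).2
  have dx : ∀ s, HasDerivAt x (deriv x s) s := fun s =>
    (hxs.differentiable (by simp) s).hasDerivAt
  have dy : ∀ s, HasDerivAt y (deriv y s) s := fun s =>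
    (hys.differentiable (by simp) s).hasDerivAt
  have dγ : ∀ s, HasDerivAt γ (deriv γ s) s := fun s =>
    (hγ.differentiable (by simp) s).hasDerivAt
  have dda : ∀ s, HasDerivAt (deriv x) (deriv (deriv x) s) s := fun s =>
    (hxs'.differentiable (by simp) s).hasDerivAt
  have ddb : ∀ s, HasDerivAt (deriv y) (deriv (deriv y) s) s := fun s =>
    (hys'.differentiable (by simp) s).hasDerivAt
  set a := deriv x with ha
  set b := deriv y with hbdef
  have hcoord : ∀ s (i : Fin 2), deriv (fun t => γ t i) s = deriv γ s i := by
    intro s i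
    have := (EuclideanSpace.proj (𝕜 := ℝ) i : EuclideanSpace ℝ (Fin 2) →L[ℝ] ℝ).hasFDerivAt.comp_hasDerivAt s (dγ s)
    exact this.deriv
  have hab : ∀ s, a s ^ 2 + b s ^ 2 = 1 := by
    intro s
    have h1 := EuclideanSpace.real_norm_sq_eq (deriv γ s)
    rw [hunit s, Fin.sum_univ_two, ← hcoord, ← hcoord] at h1
    simpa using h1.symm
  have horth : ∀ s, a s * deriv a s + b s * deriv b s = 0 := by
    intro s
    have h1 := ((dda s).pow 2).add ((ddb s).pow 2)
    have h2 : (a ^ 2 + b ^ 2) = fun _ => (1:ℝ) := by ext s; simpa using hab s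
    rw [h2] at h1
    have h3 := h1.unique (hasDerivAt_const s (1:ℝ))
    push_cast at h3
    linear_combination h3 / 2
  have da' : ∀ s, HasDerivAt a (- κ s * b s) s := by
    intro s
    refine (dda s).congr_deriv ?_
    rw [hκ s]
    linear_combination (-deriv a s) * hab s + a s * horth s
  have db' : ∀ s, HasDerivAt b (κ s * a s) s := by
    intro s
    refine (ddb s).congr_deriv ?_
    rw [hκ s]
    linear_combination (-deriv b s) * hab s + b s * horth s
  have hxp : Function.Periodic x L := fun s => by simp only [hx, hper s]
  have hyp : Function.Periodic y L := fun s => by simp only [hy, hper s]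
  have dper : ∀ f : ℝ → ℝ, Function.Periodic f L → Function.Periodic (deriv f) L := by
    intro f hf s
    rw [← deriv_comp_add_const]
    congr 1
    ext u; exact hf u
  have hap : Function.Periodic a L := dper x hxp
  have hbp : Function.Periodic b L := dper y hyp
  have hκp : Function.Periodic κ L := by
    intro s
    rw [hκ, hκ, hap, hbp, dper a hap, dper b hbp]
  let p : ℝ → ℝ := fun s => (x s - x t) * a s + (y s - y t) * b s
  let h : ℝ → ℝ := fun s => (x s - x t) * b s - (y s - y t) * a s
  have hpp : Function.Periodic p L := fun s => by simp only [p, hxp s, hyp s, hap s, hbp s]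
  have hhp : Function.Periodic h L := fun s => by simp only [h, hxp s, hyp s, hap s, hbp s]
  have dp : ∀ s, HasDerivAt p (1 - κ s * h s) s := by
    intro s
    have := (((dx s).sub_const (x t)).mul (da' s)).add (((dy s).sub_const (y t)).mul (db' s))
    refine this.congr_deriv ?_
    simp only [h]
    linear_combination hab s
  have dh : ∀ s, HasDerivAt h (κ s * p s) s := by
    intro s
    have := (((dx s).sub_const (x t)).mul (db' s)).sub (((dy s).sub_const (y t)).mul (da' s))
    refine this.congr_deriv ?_
    simp only [p]
    ring
  have hR : ∀ s, p s ^ 2 + h s ^ 2 = ‖γ s - γ t‖ ^ 2 := by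
    intro s
    rw [EuclideanSpace.real_norm_sq_eq, Fin.sum_univ_two]
    simp only [p, h, hx, hy, PiLp.sub_apply]
    linear_combination ((γ s 0 - γ t 0) ^ 2 + (γ s 1 - γ t 1) ^ 2) * hab s
  have hlip : ∀ s, ‖γ s - γ t‖ ≤ ‖s - t‖ := by
    intro s
    have := convex_univ.norm_image_sub_le_of_norm_hasDerivWithin_le (C := 1)
      (fun u _ => (dγ u).hasDerivWithinAt) (fun u _ => (hunit u).le) (Set.mem_univ t) (Set.mem_univ s)
    simpa using this
  have hk : 0 < 2 * π / L := by positivity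
  have hκ' : ∀ s, |κ s - 2 * π / L| ≤ 2 * π / L / 100 := by
    intro s
    obtain ⟨h1, h2⟩ := hb s
    have e : κ s = 2 * π / L * (L / (2 * π) * κ s) := by field_simp
    rw [abs_le, e]
    constructor <;> nlinarith
  have base : ∀ u, |u| ≤ L / 2 → 0 ≤ h (t + u) ∧
      h (t + u) ≤ κ (t + u) * (p (t + u) ^ 2 + h (t + u) ^ 2) := by
    intro u hu
    refine aux_full hk (fun u => p (t + u)) (fun u => h (t + u)) (fun u => κ (t + u))
      (fun u => (dp (t + u)).comp_const_add t u) (fun u => (dh (t + u)).comp_const_add t u)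
      (by simp [p]) (by simp [h]) (fun u => ?_) (fun u => hκ' _) (x := u) ?_
    · simp only [hR]
      have := hlip (t + u)
      rw [← sq_abs u]
      apply pow_le_pow_left₀ (norm_nonneg _)
      simpa using this
    · calc 2 * π / L * |u| ≤ 2 * π / L * (L / 2) := by gcongr
        _ = π := by field_simp
  have main : ∀ s ∈ Set.Ioo t (t + L), 0 ≤ h s ∧ h s ≤ κ s * (p s ^ 2 + h s ^ 2) := by
    intro s hs
    rcases le_total (s - t) (L / 2) with hc | hc
    · have := base (s - t) (by rw [abs_of_nonneg (by linarith [hs.1])]; exact hc)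
      simpa using this
    · have := base (s - t - L) (by rw [abs_of_nonpos (by linarith [hs.2])]; linarith)
      have e : t + (s - t - L) = s - L := by ring
      rw [e, hpp.sub_eq, hhp.sub_eq, hκp.sub_eq] at this
      exact this
  have hne : ∀ s ∈ Set.Ioo t (t + L), 0 < ‖γ s - γ t‖ := by
    intro s hs
    rw [norm_pos_iff, sub_ne_zero]
    intro heq
    have e1 : ∀ s, γ (toIcoMod hL 0 s) = γ s := fun s => hper.sub_zsmul_eq _
    have e2 : ∀ s, toIcoMod hL 0 s ∈ Set.Ico 0 L := fun s => by
      simpa using toIcoMod_mem_Ico hL 0 s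
    have e3 := hinj (e2 s) (e2 t) (by rw [e1, e1, heq])
    simp only [toIcoMod, zsmul_eq_mul] at e3
    have e4 : s - t = ((toIcoDiv hL 0 s - toIcoDiv hL 0 t : ℤ) : ℝ) * L := by
      push_cast; linarith
    set n := toIcoDiv hL 0 s - toIcoDiv hL 0 t
    have n1 : (0 : ℝ) < n := by
      by_contra hc; push Not at hc; nlinarith [hs.1]
    have n2 : (n : ℝ) < 1 := by
      by_contra hc; push Not at hc; nlinarith [hs.2]
    have n1' : 0 < n := by exact_mod_cast n1
    have n2' : n < 1 := by exact_mod_cast n2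
    omega
  have hg : ∀ s ∈ Set.Ioo t (t + L), HasDerivAt (fun s => ‖γ s - γ t‖) (p s / ‖γ s - γ t‖) s := by
    intro s hs
    have e : (fun s => ‖γ s - γ t‖) = fun s => √(p s ^ 2 + h s ^ 2) := by
      ext s; rw [hR, Real.sqrt_sq (norm_nonneg _)]
    have hpos := hne s hs
    have h1 : HasDerivAt (fun s => p s ^ 2 + h s ^ 2) (2 * p s) s := by
      refine (((dp s).pow 2).add ((dh s).pow 2)).congr_deriv ?_
      push_cast; ring
    have h2 := h1.sqrt (by rw [hR]; positivity)
    rw [e]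
    refine h2.congr_deriv ?_
    rw [hR, Real.sqrt_sq (norm_nonneg _)]
    field_simp
  have hint : interior (Set.Icc t (t + L)) = Set.Ioo t (t + L) := interior_Icc
  apply concaveOn_of_hasDerivWithinAt2_nonpos (convex_Icc _ _)
    (f' := fun s => p s / ‖γ s - γ t‖)
    (f'' := fun s => ((1 - κ s * h s) * ‖γ s - γ t‖ - p s * (p s / ‖γ s - γ t‖)) / ‖γ s - γ t‖ ^ 2)
  · exact ((hγ.continuous.sub continuous_const).norm).continuousOn
  · intro s hs; rw [hint] at hs
    exact (hg s hs).hasDerivWithinAt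
  · intro s hs; rw [hint] at hs
    exact ((dp s).div (hg s hs) (hne s hs).ne').hasDerivWithinAt
  · intro s hs; rw [hint] at hs
    obtain ⟨m1, m2⟩ := main s hs
    have hq := hne s hs
    have hRs := hR s
    set q := ‖γ s - γ t‖
    apply div_nonpos_of_nonpos_of_nonneg _ (by positivity)
    have e : (1 - κ s * h s) * q - p s * (p s / q) = h s * (h s - κ s * (p s ^ 2 + h s ^ 2)) / q := by
      field_simp
      rw [hRs]
      linear_combination -hRs
    rw [e]
    apply div_nonpos_of_nonpos_of_nonneg _ hq.le
    exact mul_nonpos_of_nonneg_of_nonpos m1 (by linarith)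

theorem stmt_2 :
    ∃ ε₀ : ℝ, 0 < ε₀ ∧
      ∀ (L : ℝ), 0 < L → ∀ (γ : ℝ → EuclideanSpace ℝ (Fin 2)),
        ContDiff ℝ (⊤ : ℕ∞) γ →
        Function.Periodic γ L →
        (∀ s : ℝ, ‖deriv γ s‖ = 1) →
        Set.InjOn γ (Set.Ico 0 L) →
        ∀ (κ : ℝ → ℝ),
        (∀ s : ℝ, κ s =
          deriv (fun t => γ t 0) s * deriv (deriv (fun t => γ t 1)) s -
            deriv (fun t => γ t 1) s * deriv (deriv (fun t => γ t 0)) s) →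
        (∀ s : ℝ, 0 < κ s) →
        (∀ s : ℝ, 1 - ε₀ ≤ L / (2 * π) * κ s ∧ L / (2 * π) * κ s ≤ 1 + ε₀) →
        ∃ (μ : Measure (EuclideanSpace ℝ (Fin 2))), IsProbabilityMeasure μ ∧
          μ (Set.range γ)ᶜ = 0 ∧
          ∃ c : ℝ, ∀ x ∈ Set.range γ, ∫ y in Set.range γ, ‖x - y‖ ∂μ = c := by
  refine ⟨1 / 100, by norm_num, ?_⟩
  intro L hL γ hγ hper hunit hinj κ hκ _ hb
  have hconc := aux_conc hL γ hγ hper hunit hinj κ hκ hb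
  have hcomp : IsCompact (Set.range γ) := hper.compact_of_continuous hL.ne' hγ.continuous
  have hms : MeasurableSet (Set.range γ) := hcomp.measurableSet
  have : CompactSpace (Set.range γ) := isCompact_iff_compactSpace.1 hcomp
  have : Nonempty (Set.range γ) := ⟨⟨γ 0, 0, rfl⟩⟩
  obtain ⟨μ, hμ, I, hUc, hle, hae⟩ := aux_max (Set.range γ)
  let pt : ℝ → Set.range γ := fun s => ⟨γ s, s, rfl⟩
  have hptc : Continuous pt := hγ.continuous.subtype_mk _
  have hptp : Function.Periodic pt L := fun s => Subtype.ext (hper s)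
  let U : ℝ → ℝ := fun s => ∫ y, dist (pt s) y ∂μ
  have hU : Continuous U := hUc.comp hptc
  have hUp : Function.Periodic U L := fun s => by simp only [U, hptp s]
  have hUle : ∀ s, U s ≤ I := fun s => hle _
  have hint : ∀ s, Integrable (fun y => dist (pt s) y) μ := fun s =>
    (by fun_prop : Continuous fun y => dist (pt s) y).integrable_of_hasCompactSupport
      (HasCompactSupport.of_compactSpace _)
  let C : Set ℝ := {s | U s = I}
  have hCc : IsClosed C := isClosed_eq hU continuous_const
  have hCp : ∀ s ∈ C, ∀ n : ℤ, s + n * L ∈ C := by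
    intro s hs n
    have := hUp.int_mul n s
    exact this.trans hs
  have hall : ∀ s0, U s0 = I := by
    intro s0
    by_contra hs0
    obtain ⟨z, hz⟩ := hae.exists
    obtain ⟨_, c, rfl⟩ := z
    have hcC : c ∈ C := hz
    have hC1 : (C ∩ Set.Iic s0).Nonempty := by
      refine ⟨toIocMod hL (s0 - L) c, ?_, ?_⟩
      · have := hCp c hcC (-toIocDiv hL (s0 - L) c)
        simpa [toIocMod, sub_eq_add_neg] using this
      · simpa using (toIocMod_mem_Ioc hL (s0 - L) c).2
    have hC2 : (C ∩ Set.Ici s0).Nonempty := by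
      refine ⟨toIocMod hL s0 c, ?_, ?_⟩
      · have := hCp c hcC (-toIocDiv hL s0 c)
        simpa [toIocMod, sub_eq_add_neg] using this
      · exact (toIocMod_mem_Ioc hL s0 c).1.le
    have hbd1 : BddAbove (C ∩ Set.Iic s0) := ⟨s0, fun z hz => hz.2⟩
    have hbd2 : BddBelow (C ∩ Set.Ici s0) := ⟨s0, fun z hz => hz.2⟩
    have hA := (hCc.inter isClosed_Iic).csSup_mem hC1 hbd1
    have hB := (hCc.inter isClosed_Ici).csInf_mem hC2 hbd2
    have hA' : ∀ z ∈ C, z ≤ s0 → z ≤ sSup (C ∩ Set.Iic s0) := fun z h1 h2 => le_csSup hbd1 ⟨h1, h2⟩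
    have hB' : ∀ z ∈ C, s0 ≤ z → sInf (C ∩ Set.Ici s0) ≤ z := fun z h1 h2 => csInf_le hbd2 ⟨h1, h2⟩
    set a := sSup (C ∩ Set.Iic s0)
    set b := sInf (C ∩ Set.Ici s0)
    have has : a ≤ s0 := hA.2
    have hsb : s0 ≤ b := hB.2
    have hseg : s0 ∈ segment ℝ a b := by
      rw [segment_eq_Icc (has.trans hsb)]; exact ⟨has, hsb⟩
    obtain ⟨α, β, hα, hβ, hαβ, hs0e⟩ := hseg
    have hineq : ∀ᵐ y ∂μ, α * dist (pt a) y + β * dist (pt b) y ≤ dist (pt s0) y := by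
      filter_upwards [hae] with z hz
      obtain ⟨_, c, rfl⟩ := z
      have hcC : c ∈ C := hz
      set t := toIocMod hL (a - L) c with ht
      have htC : t ∈ C := by
        have := hCp c hcC (-toIocDiv hL (a - L) c)
        simpa [ht, toIocMod, sub_eq_add_neg] using this
      have htm := toIocMod_mem_Ioc hL (a - L) c
      have htγ : γ t = γ c := hper.sub_zsmul_eq _
      have ht1 : t ≤ a := by linarith [htm.2]
      have ht2 : a < t + L := by linarith [htm.1]
      have htL : t + L ∈ C := by simpa using hCp t htC 1
      have ht3 : s0 ≤ t + L := by
        by_contra hc; push Not at hc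
        linarith [hA' _ htL hc.le]
      have ht4 := hB' _ htL ht3
      have := (hconc t).2 (x := a) ⟨ht1, ht2.le⟩ (y := b) ⟨by linarith, ht4⟩ hα hβ hαβ
      rw [hs0e, htγ] at this
      simpa [Subtype.dist_eq, pt, dist_eq_norm] using this
    have hi := integral_mono_ae (((hint a).const_mul α).add ((hint b).const_mul β)) (hint s0) hineq
    have hi2 : ∫ y, (α * dist (pt a) y + β * dist (pt b) y) ∂μ = α * U a + β * U b := by
      rw [integral_add ((hint a).const_mul α) ((hint b).const_mul β), integral_const_mul,
        integral_const_mul]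
    have hi3 : α * U a + β * U b ≤ U s0 := by rw [← hi2]; exact hi
    have ea : U a = I := hA.1
    have eb : U b = I := hB.1
    rw [ea, eb, ← add_mul, hαβ, one_mul] at hi3
    exact hs0 (le_antisymm (hUle s0) hi3)
  have hme : MeasurableEmbedding (Subtype.val : Set.range γ → EuclideanSpace ℝ (Fin 2)) :=
    MeasurableEmbedding.subtype_coe hms
  have hnull : (μ.map Subtype.val) (Set.range γ)ᶜ = 0 := by
    rw [hme.map_apply]
    simp
  refine ⟨μ.map Subtype.val, Measure.isProbabilityMeasure_map hme.measurable.aemeasurable, hnull, I, ?_⟩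
  rintro _ ⟨s, rfl⟩
  have hr : (μ.map Subtype.val).restrict (Set.range γ) = μ.map Subtype.val := by
    apply Measure.restrict_eq_self_of_ae_mem
    rw [ae_iff]; exact hnull
  rw [hr, hme.integral_map, ← hall s]
  simp only [U, pt, Subtype.dist_eq, dist_eq_norm]
end

section
/- Let (X, d) be a compact, connected metric space. Then there exists a unique real number r such that: for every n ≥ 1 and every (not necessarily distinct) x₁, …, xₙ ∈ X, there exists a point x ∈ X with (1/n) · Σᵢ₌₁ⁿ d(x, xᵢ) = r. Moreover, if X has at least two points then r > 0. -/
def RV (X : Type*) [MetricSpace X] (r : ℝ) : Prop :=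
  ∀ n : ℕ, 1 ≤ n → ∀ x : Fin n → X, ∃ p : X, (1 / (n : ℝ)) * ∑ i, dist p (x i) = r

theorem RV.fintype {X : Type*} [MetricSpace X] {r : ℝ} (h : RV X r) {κ : Type*} [Fintype κ]
    [Nonempty κ] (x : κ → X) : ∃ p : X, ∑ i, dist p (x i) = Fintype.card κ * r := by
  have hc : 0 < Fintype.card κ := Fintype.card_pos
  obtain ⟨p, hp⟩ := h (Fintype.card κ) hc (fun j => x ((Fintype.equivFin κ).symm j))
  refine ⟨p, ?_⟩
  have e := Equiv.sum_comp (Fintype.equivFin κ).symm (fun j => dist p (x j))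
  rw [e] at hp
  rw [← hp]
  have : (Fintype.card κ : ℝ) ≠ 0 := by positivity
  field_simp

theorem RV.weights {X : Type*} [MetricSpace X] [CompactSpace X] {r : ℝ} (h : RV X r) {ι : Type*}
    [Fintype ι] [Nonempty ι] (x : ι → X) (w : ι → ℝ) (hw : ∀ i, 0 ≤ w i) (hs : ∑ i, w i = 1)
    (ε : ℝ) (hε : 0 < ε) : ∃ p : X, |∑ i, w i * dist p (x i) - r| ≤ ε := by
  set k : ℝ := (Fintype.card ι : ℝ) with hk
  set D : ℝ := Metric.diam (Set.univ : Set X) with hD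
  have hd : ∀ a b : X, dist a b ≤ D := fun a b =>
    Metric.dist_le_diam_of_mem isCompact_univ.isBounded (Set.mem_univ a) (Set.mem_univ b)
  have hk0 : 0 ≤ k := by positivity
  obtain ⟨N, hN⟩ := exists_nat_gt ((k * D + k * |r|) / ε)
  have hD0 : 0 ≤ D := Metric.diam_nonneg
  have hNpos : (0 : ℝ) < N := lt_of_le_of_lt (by positivity) hN
  rw [div_lt_iff₀ hε] at hN
  let n : ι → ℕ := fun i => ⌊N * w i⌋₊ + 1
  have hn : ∀ i, |N * w i - n i| ≤ 1 := by
    intro i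
    have h0 : 0 ≤ N * w i := mul_nonneg hNpos.le (hw i)
    have h1 := Nat.floor_le h0
    have h2 := Nat.lt_floor_add_one (N * w i)
    simp only [n]
    push_cast
    rw [abs_le]; constructor <;> linarith
  haveI : Nonempty ((i : ι) × Fin (n i)) := ⟨⟨Classical.arbitrary ι, ⟨0, Nat.succ_pos _⟩⟩⟩
  obtain ⟨p, hp⟩ := h.fintype (κ := (i : ι) × Fin (n i)) (fun z => x z.1)
  refine ⟨p, ?_⟩
  rw [Fintype.sum_sigma] at hp
  simp only [Finset.sum_const, Finset.card_univ, Fintype.card_fin, nsmul_eq_mul,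
    Fintype.card_sigma, Nat.cast_sum] at hp
  have key : N * (∑ i, w i * dist p (x i) - r) =
      ∑ i, (N * w i - n i) * dist p (x i) - (∑ i, (N * w i - n i)) * r := by
    simp only [sub_mul, Finset.sum_sub_distrib, hp, ← Finset.mul_sum, hs, mul_assoc]
    ring
  have b1 : |∑ i, (N * w i - n i) * dist p (x i)| ≤ k * D := by
    calc _ ≤ ∑ i, |(N * w i - n i) * dist p (x i)| := Finset.abs_sum_le_sum_abs _ _
      _ ≤ ∑ i : ι, D := by
        refine Finset.sum_le_sum fun i _ => ?_
        rw [abs_mul, abs_of_nonneg (dist_nonneg (x := p))]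
        nlinarith [hn i, hd p (x i), dist_nonneg (x := p) (y := x i), abs_nonneg (N * w i - n i)]
      _ = k * D := by simp [hk]
  have b2 : |(∑ i, (N * w i - n i)) * r| ≤ k * |r| := by
    rw [abs_mul]
    refine mul_le_mul_of_nonneg_right ?_ (abs_nonneg _)
    calc _ ≤ ∑ i, |(N * w i - n i)| := Finset.abs_sum_le_sum_abs _ _
      _ ≤ ∑ i : ι, (1 : ℝ) := Finset.sum_le_sum fun i _ => hn i
      _ = k := by simp [hk]
  have b3 : N * |∑ i, w i * dist p (x i) - r| ≤ k * D + k * |r| := by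
    rw [← abs_of_pos hNpos, ← abs_mul, key]
    exact (abs_sub _ _).trans (add_le_add b1 b2)
  refine le_of_mul_le_mul_left (b3.trans ?_) hNpos
  exact hN.le

theorem RV.not_lt {X : Type*} [MetricSpace X] [CompactSpace X] [Nonempty X] {r s : ℝ}
    (hr : RV X r) (hs : RV X s) : ¬ r < s := by
  intro hlt
  set ε := (s - r) / 4 with hε
  have hε0 : 0 < ε := by simp only [hε]; linarith
  obtain ⟨N, -, hNf, hN⟩ := finite_cover_balls_of_compact (isCompact_univ (X := X)) hε0
  have hnet : ∀ p : X, ∃ t : N, dist p t < ε := by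
    intro p
    have := hN (Set.mem_univ p)
    simp only [Set.mem_iUnion, Metric.mem_ball] at this
    obtain ⟨t, ht, h⟩ := this
    exact ⟨⟨t, ht⟩, h⟩
  haveI : Fintype N := hNf.fintype
  classical
  let v : X → (N → ℝ) := fun p t => dist (t : X) p
  let U : Set (N → ℝ) := Set.pi Set.univ fun _ => Set.Iio (s - 2 * ε)
  have hUo : IsOpen U := isOpen_set_pi Set.finite_univ fun _ _ => isOpen_Iio
  have hUc : Convex ℝ U := convex_pi fun _ _ => convex_Iio _
  have hdis : Disjoint U (convexHull ℝ (Set.range v)) := by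
    rw [Set.disjoint_left]
    intro g hgU hgK
    rw [mem_convexHull_iff_exists_fintype] at hgK
    obtain ⟨ι, _, w, z, hw, hw1, hz, hg⟩ := hgK
    choose x hx using hz
    haveI : Nonempty ι := by
      by_contra hne
      rw [not_nonempty_iff] at hne
      simp at hw1
    obtain ⟨p, hp⟩ := hs.weights x w hw hw1 ε hε0
    obtain ⟨t, ht⟩ := hnet p
    have h1 : g t < s - 2 * ε := hgU t (Set.mem_univ _)
    have h2 : g t = ∑ i, w i * dist (t : X) (x i) := by
      rw [← hg]; simp [← hx, v]
    have h3 : ∑ i, w i * dist p (x i) ≤ ∑ i, w i * (dist p t + dist (t : X) (x i)) :=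
      Finset.sum_le_sum fun i _ => mul_le_mul_of_nonneg_left (dist_triangle _ _ _) (hw i)
    simp only [mul_add, Finset.sum_add_distrib, ← Finset.sum_mul, hw1] at h3
    rw [abs_le] at hp
    linarith [hp.1]
  obtain ⟨f, u, hfU, hfK⟩ := geometric_hahn_banach_open hUc hUo (convex_convexHull ℝ _) hdis
  let c : N → ℝ := fun t => f (Pi.single t 1)
  have hf : ∀ g : N → ℝ, f g = ∑ t, c t * g t := by
    intro g
    conv_lhs => rw [pi_eq_sum_univ' g]
    simp [c, mul_comm]
  have hfK' : ∀ p, u ≤ ∑ t, c t * dist (t : X) p := by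
    intro p
    rw [← hf (fun t => dist (t : X) p)]
    exact hfK _ (subset_convexHull ℝ _ ⟨p, rfl⟩)
  have hfU' : ∀ g : N → ℝ, (∀ t, g t < s - 2 * ε) → ∑ t, c t * g t < u := by
    intro g hg
    rw [← hf g]
    exact hfU _ fun t _ => hg t
  have hc : ∀ t, 0 ≤ c t := by
    intro t
    by_contra hneg
    push Not at hneg
    have hb := hfU' (fun _ => s - 3 * ε) (fun _ => by linarith)
    set B := ∑ t, c t * (s - 3 * ε) with hB
    have hM : 0 ≤ (u - B) / (- c t) := div_nonneg (by linarith) (by linarith)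
    have := hfU' (fun a => (s - 3 * ε) - Pi.single (M := fun _ => ℝ) t ((u - B) / (- c t)) a) (by
      intro a
      by_cases hat : a = t
      · subst hat; simp only [Pi.single_eq_same]; linarith
      · simp only [Pi.single_eq_of_ne hat]; linarith)
    simp only [mul_sub, Finset.sum_sub_distrib] at this
    rw [Finset.sum_eq_single t (f := fun a => c a * Pi.single (M := fun _ => ℝ) t ((u - B) / (- c t)) a)
      (by intro b _ hbt; simp [hbt]) (by simp)] at this
    simp only [Pi.single_eq_same] at this
    have e : c t * ((u - B) / (- c t)) = -(u - B) := by
      have := hneg.ne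
      field_simp
    rw [e] at this
    simp only [mul_sub, Finset.sum_sub_distrib] at hB
    linarith
  have hlow := hfU' (fun _ => s - 3 * ε) (fun _ => by linarith)
  rw [← Finset.sum_mul] at hlow
  set C := ∑ t, c t with hC
  have hC0 : 0 < C := by
    rcases (Finset.sum_nonneg fun t _ => hc t : 0 ≤ C).lt_or_eq with h | h
    · exact h
    · exfalso
      have hz := (Finset.sum_eq_zero_iff_of_nonneg fun t _ => hc t).1 h.symm
      have h2 := hfK' (Classical.arbitrary X)
      rw [Finset.sum_eq_zero (fun t ht => by rw [hz t ht, zero_mul])] at h2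
      rw [hC, ← h, zero_mul] at hlow
      linarith
  haveI : Nonempty N := ⟨(hnet (Classical.arbitrary X)).choose⟩
  obtain ⟨p, hp⟩ := hr.weights (fun t : N => (t : X)) (fun t => c t / C)
    (fun t => div_nonneg (hc t) hC0.le) (by rw [← Finset.sum_div]; exact div_self hC0.ne') ε hε0
  have h1 := hfK' p
  have h2 : ∑ t : N, c t / C * dist p t = (∑ t : N, c t * dist (t : X) p) / C := by
    rw [Finset.sum_div]
    refine Finset.sum_congr rfl fun t _ => ?_
    rw [dist_comm]; ring
  rw [h2, abs_le] at hp
  have h3 : s - 3 * ε < (∑ t : N, c t * dist (t : X) p) / C := by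
    rw [lt_div_iff₀ hC0]; linarith
  have h4 : s - 3 * ε = r + ε := by simp only [hε]; ring
  linarith [hp.2]

theorem RV.exists (X : Type*) [MetricSpace X] [CompactSpace X] [ConnectedSpace X] [Nonempty X] :
    ∃ r, RV X r := by
  let F : (Σ n : ℕ, (Fin (n + 1) → X)) → X → ℝ :=
    fun z p => (1 / ((z.1 + 1 : ℕ) : ℝ)) * ∑ i, dist p (z.2 i)
  have hF : ∀ z, Continuous (F z) := fun z => by fun_prop
  have hmin : ∀ z, ∃ a, ∀ p, F z a ≤ F z p := fun z => by
    obtain ⟨a, -, ha⟩ := isCompact_univ.exists_isMinOn Set.univ_nonempty (hF z).continuousOn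
    exact ⟨a, fun p => ha (Set.mem_univ p)⟩
  have hmax : ∀ z, ∃ a, ∀ p, F z p ≤ F z a := fun z => by
    obtain ⟨a, -, ha⟩ := isCompact_univ.exists_isMaxOn Set.univ_nonempty (hF z).continuousOn
    exact ⟨a, fun p => ha (Set.mem_univ p)⟩
  choose a ha using hmin
  choose b hb using hmax
  have hab : ∀ z y, F z (a z) ≤ F y (b y) := by
    intro z y
    have e : (1 / ((y.1 + 1 : ℕ) : ℝ)) * ∑ j, F z (y.2 j) =
        (1 / ((z.1 + 1 : ℕ) : ℝ)) * ∑ i, F y (z.2 i) := by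
      simp only [F, ← Finset.mul_sum]
      rw [Finset.sum_comm]
      simp only [dist_comm]
      ring
    have cst : ∀ (n : ℕ) (q : ℝ), (1 / ((n + 1 : ℕ) : ℝ)) * ∑ _j : Fin (n + 1), q = q := by
      intro n q
      simp only [Finset.sum_const, Finset.card_univ, Fintype.card_fin, nsmul_eq_mul]
      have : ((n + 1 : ℕ) : ℝ) ≠ 0 := by positivity
      field_simp
    calc F z (a z) = (1 / ((y.1 + 1 : ℕ) : ℝ)) * ∑ _j : Fin (y.1 + 1), F z (a z) := (cst _ _).symm
      _ ≤ (1 / ((y.1 + 1 : ℕ) : ℝ)) * ∑ j, F z (y.2 j) :=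
        mul_le_mul_of_nonneg_left (Finset.sum_le_sum fun j _ => ha z _) (by positivity)
      _ = _ := e
      _ ≤ (1 / ((z.1 + 1 : ℕ) : ℝ)) * ∑ _i : Fin (z.1 + 1), F y (b y) :=
        mul_le_mul_of_nonneg_left (Finset.sum_le_sum fun j _ => hb y _) (by positivity)
      _ = _ := cst _ _
  haveI : Nonempty (Σ n : ℕ, (Fin (n + 1) → X)) := ⟨⟨0, fun _ => Classical.arbitrary X⟩⟩
  refine ⟨⨆ z, F z (a z), ?_⟩
  intro n hn x
  obtain ⟨m, rfl⟩ : ∃ m, n = m + 1 := ⟨n - 1, by omega⟩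
  let y : Σ n : ℕ, (Fin (n + 1) → X) := ⟨m, x⟩
  have h1 : F y (a y) ≤ ⨆ z, F z (a z) :=
    le_ciSup (f := fun z => F z (a z)) ⟨F y (b y), by rintro _ ⟨z, rfl⟩; exact hab z y⟩ y
  have h2 : ⨆ z, F z (a z) ≤ F y (b y) := ciSup_le fun z => hab z y
  exact mem_range_of_exists_le_of_exists_ge (hF y) ⟨_, h1⟩ ⟨_, h2⟩


/-- **Gross's Theorem (1964).** A nonempty compact connected metric space `X` has a
unique rendezvous number `r`: for every `n ≥ 1` and every list `x₁, …, xₙ ∈ X` there is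
`x ∈ X` with `(1/n) ∑ d(x, xᵢ) = r`. Moreover, if `X` has at least two points, `r > 0`. -/
theorem stmt_3 (X : Type*) [MetricSpace X] [CompactSpace X] [ConnectedSpace X]
    [Nonempty X] :
    (∃! r : ℝ, ∀ n : ℕ, 1 ≤ n → ∀ x : Fin n → X,
        ∃ p : X, (1 / (n : ℝ)) * ∑ i, dist p (x i) = r) ∧
      (∀ r : ℝ, (∀ n : ℕ, 1 ≤ n → ∀ x : Fin n → X,
          ∃ p : X, (1 / (n : ℝ)) * ∑ i, dist p (x i) = r) →
        (∃ a b : X, a ≠ b) → 0 < r) := by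
  refine ⟨?_, ?_⟩
  · obtain ⟨r, hr⟩ := RV.exists X
    refine ⟨r, hr, ?_⟩
    intro s hs
    exact le_antisymm (not_lt.1 (RV.not_lt hr hs)) (not_lt.1 (RV.not_lt hs hr))
  · rintro r hr ⟨a, b, hab⟩
    obtain ⟨p, hp⟩ := hr 2 (by norm_num) ![a, b]
    simp only [Fin.sum_univ_two, Matrix.cons_val_zero, Matrix.cons_val_one] at hp
    have h1 := dist_pos.2 hab
    have h2 := dist_triangle_left a b p
    norm_num at hp
    linarith
end

section
/- Let (X, d) be a compact, connected metric space and suppose r ∈ ℝ has the rendezvous property: for every n ≥ 1 and every x₁, …, xₙ ∈ X there exists x ∈ X with (1/n) · Σᵢ₌₁ⁿ d(x, xᵢ) = r. Then diam(X)/2 ≤ r ≤ diam(X), where diam(X) = sup{d(x, y) : x, y ∈ X}. -/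
/-- If `r` has the rendezvous property on a nonempty compact connected metric space `X`,
then `diam(X)/2 ≤ r ≤ diam(X)`. -/
theorem stmt_4 (X : Type*) [MetricSpace X] [CompactSpace X] [ConnectedSpace X]
    [Nonempty X] (r : ℝ)
    (hr : ∀ n : ℕ, 1 ≤ n → ∀ x : Fin n → X,
      ∃ p : X, (1 / (n : ℝ)) * ∑ i, dist p (x i) = r) :
    Metric.diam (Set.univ : Set X) / 2 ≤ r ∧ r ≤ Metric.diam (Set.univ : Set X) := by
  obtain ⟨a⟩ := ‹Nonempty X›
  obtain ⟨q, hq⟩ := hr 1 le_rfl (fun _ => a)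
  simp at hq
  have h0 : 0 ≤ r := hq ▸ dist_nonneg
  refine ⟨?_, ?_⟩
  · have : Metric.diam (Set.univ : Set X) ≤ 2 * r := by
      refine Metric.diam_le_of_forall_dist_le (by linarith) ?_
      intro x _ y _
      obtain ⟨p, hp⟩ := hr 2 (by norm_num) ![x, y]
      simp [Fin.sum_univ_two] at hp
      have := dist_triangle_left x y p
      linarith
    linarith
  · rw [← hq]
    exact Metric.dist_le_diam_of_mem isCompact_univ.isBounded (Set.mem_univ _) (Set.mem_univ _)
end

section
/- Let (X, d) be a compact, connected metric space and let μ be a Borel probability measure on X such that ∫_X d(x, y) dμ(y) = c for every x ∈ X, where c is a constant. Then for every n ≥ 1 and every x₁, …, xₙ ∈ X there exists a point x ∈ X with (1/n) · Σᵢ₌₁ⁿ d(x, xᵢ) = c (i.e., c is the rendezvous number of (X, d)). -/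
open MeasureTheory

/-- If a Borel probability measure `μ` on a compact connected metric space `X` satisfies
`∫ d(x,y) dμ(y) = c` for every `x`, then `c` has the rendezvous property: for every
`n ≥ 1` and `x₁, …, xₙ ∈ X` there is `x ∈ X` with `(1/n) ∑ d(x, xᵢ) = c`. -/
theorem stmt_5 (X : Type*) [MetricSpace X] [CompactSpace X] [ConnectedSpace X]
    [MeasurableSpace X] [BorelSpace X]
    (μ : Measure X) (hμ : IsProbabilityMeasure μ) (c : ℝ)
    (hconst : ∀ x : X, ∫ y, dist x y ∂μ = c) :
    ∀ n : ℕ, 1 ≤ n → ∀ x : Fin n → X,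
      ∃ p : X, (1 / (n : ℝ)) * ∑ i, dist p (x i) = c := by
  intro n hn x
  have hn0 : (n : ℝ) ≠ 0 := by positivity
  have hint : ∀ f : X → ℝ, Continuous f → Integrable f μ := fun f hf =>
    hf.integrable_of_hasCompactSupport (HasCompactSupport.of_compactSpace f)
  have hf : Continuous (fun p : X => (1 / (n : ℝ)) * ∑ i, dist p (x i)) := by fun_prop
  have hI : ∫ p, (1 / (n : ℝ)) * ∑ i, dist p (x i) ∂μ = c := by
    rw [integral_const_mul, integral_finsetSum _ (fun i _ => hint _ (by fun_prop))]
    have h : ∀ i, ∫ p, dist p (x i) ∂μ = c := fun i => by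
      simp_rw [dist_comm _ (x i)]
      exact hconst _
    simp only [h, Finset.sum_const, Finset.card_univ, Fintype.card_fin, nsmul_eq_mul]
    field_simp
  obtain ⟨a, ha⟩ := exists_le_integral (hint _ hf)
  obtain ⟨b, hb⟩ := exists_integral_le (hint _ hf)
  rw [hI] at ha hb
  exact mem_range_of_exists_le_of_exists_ge hf ⟨a, ha⟩ ⟨b, hb⟩
end

section
/- Let n ≥ 1, let Ω ⊆ ℝⁿ be a nonempty compact set, and let μ* be a Borel probability measure on Ω maximizing the functional I(μ) = ∫_Ω ∫_Ω ‖x − y‖ dμ(x) dμ(y) over all Borel probability measures on Ω. Then for every x in the support of μ* one has ∫_Ω ‖x − y‖ dμ*(y) = I(μ*), and for every x ∈ Ω one has ∫_Ω ‖x − y‖ dμ*(y) ≤ I(μ*). -/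
open MeasureTheory

/-- The support of a Borel measure: points all of whose open neighborhoods have
positive measure. -/
def measureSupport {α : Type*} [TopologicalSpace α] [MeasurableSpace α]
    (μ : Measure α) : Set α :=
  {x | ∀ U : Set α, IsOpen U → x ∈ U → 0 < μ U}

/-- **Björck, Euler–Lagrange condition.** If `μ*` maximizes the energy
`I(μ) = ∫_Ω ∫_Ω ‖x - y‖ dμ(x) dμ(y)` over probability measures on a nonempty compact
`Ω ⊆ ℝⁿ`, then `∫_Ω ‖x - y‖ dμ*(y) = I(μ*)` on the support of `μ*` and
`∫_Ω ‖x - y‖ dμ*(y) ≤ I(μ*)` everywhere on `Ω`. -/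
theorem stmt_7 (n : ℕ) (hn : 1 ≤ n) (Ω : Set (EuclideanSpace ℝ (Fin n)))
    (hΩc : IsCompact Ω) (hΩne : Ω.Nonempty)
    (μs : Measure (EuclideanSpace ℝ (Fin n))) (hμs : IsProbabilityMeasure μs)
    (hsupp : μs Ωᶜ = 0)
    (hmax : ∀ μ : Measure (EuclideanSpace ℝ (Fin n)), IsProbabilityMeasure μ → μ Ωᶜ = 0 →
      (∫ y in Ω, ∫ x in Ω, ‖x - y‖ ∂μ ∂μ) ≤ ∫ y in Ω, ∫ x in Ω, ‖x - y‖ ∂μs ∂μs) :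
    (∀ x ∈ measureSupport μs,
        (∫ y in Ω, ‖x - y‖ ∂μs) = ∫ y in Ω, ∫ x in Ω, ‖x - y‖ ∂μs ∂μs) ∧
      (∀ x ∈ Ω,
        (∫ y in Ω, ‖x - y‖ ∂μs) ≤ ∫ y in Ω, ∫ x in Ω, ‖x - y‖ ∂μs ∂μs) := by
  have haeΩ : ∀ μ : Measure (EuclideanSpace ℝ (Fin n)), μ Ωᶜ = 0 → μ.restrict Ω = μ := by
    intro μ h
    exact Measure.restrict_eq_self_of_ae_mem (by rw [ae_iff]; exact h)
  have hres := haeΩ μs hsupp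
  have hint : ∀ f : EuclideanSpace ℝ (Fin n) → ℝ, Continuous f → Integrable f μs := by
    intro f hf
    have h := hf.continuousOn.integrableOn_compact (μ := μs) hΩc
    rwa [IntegrableOn, hres] at h
  simp only [hres] at hmax ⊢
  have hi1 : ∀ y, Integrable (fun x => ‖x - y‖) μs := fun y => hint _ (by fun_prop)
  obtain ⟨p, hp⟩ : ∃ p : EuclideanSpace ℝ (Fin n) → ℝ, p = fun y => ∫ x, ‖x - y‖ ∂μs := ⟨_, rfl⟩
  have hpe : ∀ y, ∫ x, ‖x - y‖ ∂μs = p y := fun y => by rw [hp]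
  have hpe' : ∀ y, ∫ x, ‖y - x‖ ∂μs = p y := fun y => by simp_rw [norm_sub_rev y]; exact hpe y
  simp only [hpe, hpe'] at hmax ⊢
  have hpc : Continuous p := by
    refine (LipschitzWith.of_dist_le_mul (K := 1) (fun a b => ?_)).continuous
    rw [Real.dist_eq, ← hpe, ← hpe, ← integral_sub (hi1 a) (hi1 b), ← Real.norm_eq_abs]
    refine (norm_integral_le_of_norm_le_const (C := dist a b)
      (Filter.Eventually.of_forall fun x => ?_)).trans (by simp)
    have h := abs_norm_sub_norm_le (x - a) (x - b)
    rw [sub_sub_sub_cancel_left, ← dist_eq_norm b a, dist_comm b a] at h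
    exact h
  have hpi := hint p hpc
  obtain ⟨I, hI⟩ : ∃ I : ℝ, I = ∫ y, p y ∂μs := ⟨_, rfl⟩
  rw [← hI] at hmax ⊢
  have key : ∀ x ∈ Ω, p x ≤ I := by
    intro x₀ hx₀
    have step : ∀ s t : NNReal, s + t = 1 →
        (s : ℝ) * (s * I + t * p x₀) + t * (s * p x₀) ≤ I := by
      intro s t hst
      have hdx : ∀ f : EuclideanSpace ℝ (Fin n) → ℝ, Continuous f →
          Integrable f (Measure.dirac x₀) := fun f hf => integrable_dirac (by simp)
      have hgen : ∀ f : EuclideanSpace ℝ (Fin n) → ℝ, Continuous f →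
          ∫ x, f x ∂(s • μs + t • Measure.dirac x₀) = s * ∫ x, f x ∂μs + t * f x₀ := by
        intro f hf
        rw [integral_add_measure (hint f hf).smul_measure_nnreal
          (hdx f hf).smul_measure_nnreal, integral_smul_nnreal_measure,
          integral_smul_nnreal_measure, integral_dirac]
        rfl
      have hΩ0 : (s • μs + t • Measure.dirac x₀) Ωᶜ = 0 := by
        simp [hsupp, hx₀, hΩc.measurableSet.compl]
      have hprob : IsProbabilityMeasure (s • μs + t • Measure.dirac x₀) := by
        constructor
        simp only [Measure.coe_add, Pi.add_apply, Measure.smul_apply, measure_univ]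
        rw [← add_smul, hst, one_smul]
      have h := hmax _ hprob hΩ0
      rw [haeΩ _ hΩ0] at h
      have h1 : ∀ y, ∫ x, ‖x - y‖ ∂(s • μs + t • Measure.dirac x₀)
          = s * p y + t * ‖x₀ - y‖ := fun y => by
        rw [hgen _ (by fun_prop), hpe]
      simp_rw [h1] at h
      rw [hgen _ (by fun_prop), integral_add (hpi.const_mul _)
        ((hint _ (by fun_prop)).const_mul _), integral_const_mul, integral_const_mul, hpe',
        ← hI] at h
      simpa using h
    by_contra! hlt
    have hI0 : 0 ≤ I := by
      rw [hI, hp]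
      positivity
    have hpp : 0 < p x₀ := hI0.trans_lt hlt
    -- choose t = (p - I) / p
    have ht0 : 0 < (p x₀ - I) / p x₀ := div_pos (by linarith) hpp
    have hs0 : 0 ≤ I / p x₀ := by positivity
    have hst : I / p x₀ + (p x₀ - I) / p x₀ = 1 := by field_simp; ring
    have h1 := step ⟨I / (2 * p x₀) + 1 / 2, by positivity⟩
      ⟨(p x₀ - I) / p x₀ / 2, by positivity⟩ (by
        apply NNReal.eq
        change I / (2 * p x₀) + 1 / 2 + (p x₀ - I) / p x₀ / 2 = 1
        field_simp; ring)
    change (I / (2 * p x₀) + 1 / 2) * ((I / (2 * p x₀) + 1 / 2) * I + (p x₀ - I) / p x₀ / 2 * p x₀)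
      + (p x₀ - I) / p x₀ / 2 * ((I / (2 * p x₀) + 1 / 2) * p x₀) ≤ I at h1
    obtain ⟨r, hr⟩ : ∃ r, r = I / p x₀ := ⟨_, rfl⟩
    have e1 : I / (2 * p x₀) = r / 2 := by rw [hr]; field_simp
    have e2 : (p x₀ - I) / p x₀ = 1 - r := by rw [hr]; field_simp
    have e3 : I = r * p x₀ := by rw [hr]; field_simp
    rw [e1, e2] at h1
    rw [e2] at ht0
    rw [e3] at h1
    have hr0 : 0 ≤ r := hr ▸ hs0
    have : 0 < (1 - r) * (1 - r) * p x₀ * (2 + r) := by positivity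
    nlinarith
  refine ⟨fun x hx => ?_, key⟩
  have hae : ∀ᵐ y ∂μs, y ∈ Ω := by rw [ae_iff]; exact hsupp
  have h0 : (fun y => I - p y) =ᵐ[μs] 0 := by
    rw [← integral_eq_zero_iff_of_nonneg_ae]
    · rw [integral_sub (integrable_const _) hpi, ← hI]; simp
    · filter_upwards [hae] with y hy
      simpa using key y hy
    · exact (integrable_const _).sub hpi
  by_contra hne
  have hU : IsOpen {y | p y ≠ I} := isOpen_ne_fun hpc continuous_const
  refine (hx _ hU hne).ne' ?_
  have h2 : ∀ᵐ y ∂μs, p y = I := by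
    filter_upwards [h0] with y hy
    have : I - p y = 0 := hy
    linarith
  exact h2
end

section
/- Let n ≥ 1, let Ω ⊆ ℝⁿ be a nonempty compact set, and let μ* be a Borel probability measure on Ω maximizing I(μ) = ∫_Ω ∫_Ω ‖x − y‖ dμ(x) dμ(y) over all Borel probability measures on Ω. Then the support of μ* is contained in the topological boundary ∂Ω of Ω (the frontier of Ω in ℝⁿ). -/
open MeasureTheory

theorem aux_int {n : ℕ} {Ω : Set (EuclideanSpace ℝ (Fin n))} (hΩc : IsCompact Ω)
    (μ : Measure (EuclideanSpace ℝ (Fin n))) [IsFiniteMeasure μ] (h : μ Ωᶜ = 0)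
    (f : EuclideanSpace ℝ (Fin n) → ℝ) (hf : Continuous f) : Integrable f μ := by
  obtain ⟨C, hC⟩ := hΩc.exists_bound_of_continuousOn hf.continuousOn
  refine Integrable.of_bound hf.aestronglyMeasurable C ?_
  have : ∀ᵐ x ∂μ, x ∈ Ω := h
  filter_upwards [this] with x hx using hC x hx

theorem aux_pot {n : ℕ} {Ω : Set (EuclideanSpace ℝ (Fin n))} (hΩc : IsCompact Ω)
    (μ : Measure (EuclideanSpace ℝ (Fin n))) [IsProbabilityMeasure μ] (h : μ Ωᶜ = 0) :
    Continuous (fun y => ∫ x, ‖x - y‖ ∂μ) := by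
  refine (LipschitzWith.of_dist_le_mul (K := 1) fun a b => ?_).continuous
  have ia := aux_int hΩc μ h (fun x => ‖x - a‖) (by fun_prop)
  have ib := aux_int hΩc μ h (fun x => ‖x - b‖) (by fun_prop)
  rw [Real.dist_eq, ← integral_sub ia ib]
  have := norm_integral_le_of_norm_le_const (μ := μ) (f := fun x => ‖x - a‖ - ‖x - b‖)
    (C := dist a b) (Filter.Eventually.of_forall fun x => by
      have := abs_norm_sub_norm_le (x - a) (x - b)
      rw [Real.norm_eq_abs, dist_comm, dist_eq_norm]
      convert this using 2
      abel)
  simpa using this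

theorem stmt_8 (n : ℕ) (hn : 1 ≤ n) (Ω : Set (EuclideanSpace ℝ (Fin n)))
    (hΩc : IsCompact Ω) (hΩne : Ω.Nonempty)
    (μs : Measure (EuclideanSpace ℝ (Fin n))) (hμs : IsProbabilityMeasure μs)
    (hsupp : μs Ωᶜ = 0)
    (hmax : ∀ μ : Measure (EuclideanSpace ℝ (Fin n)), IsProbabilityMeasure μ → μ Ωᶜ = 0 →
      (∫ y in Ω, ∫ x in Ω, ‖x - y‖ ∂μ ∂μ) ≤ ∫ y in Ω, ∫ x in Ω, ‖x - y‖ ∂μs ∂μs) :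
    measureSupport μs ⊆ frontier Ω := by
  have hres : ∀ μ : Measure (EuclideanSpace ℝ (Fin n)), μ Ωᶜ = 0 → μ.restrict Ω = μ :=
    fun μ h => Measure.restrict_eq_self_of_ae_mem h
  set U : EuclideanSpace ℝ (Fin n) → ℝ := fun y => ∫ x, ‖x - y‖ ∂μs with hU
  have hUc : Continuous U := aux_pot hΩc μs hsupp
  set I : ℝ := ∫ y, U y ∂μs with hI
  have hU0 : ∀ y, 0 ≤ U y := fun y => integral_nonneg fun x => norm_nonneg _
  have hI0 : 0 ≤ I := integral_nonneg hU0
  have hae : ∀ᵐ x ∂μs, x ∈ Ω := hsupp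
  -- first-order condition
  have key : ∀ p ∈ Ω, U p ≤ I := by
    intro p hp
    have quad : ∀ t : ℝ, 0 < t → t < 1 →
        (1 - t) * ((1 - t) * I + t * U p) + t * ((1 - t) * U p) ≤ I := by
      intro t t0 t1
      have t1' : 0 ≤ 1 - t := by linarith
      let ν : Measure (EuclideanSpace ℝ (Fin n)) :=
        ENNReal.ofReal (1 - t) • μs + ENNReal.ofReal t • Measure.dirac p
      have hν : IsProbabilityMeasure ν := ⟨by
        simp only [ν, Measure.add_apply, Measure.smul_apply, measure_univ, smul_eq_mul, mul_one]
        rw [← ENNReal.ofReal_add t1' t0.le]; simp⟩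
      have hνs : ν Ωᶜ = 0 := by
        have : Measure.dirac p Ωᶜ = 0 := by
          rw [Measure.dirac_apply' _ hΩc.isClosed.measurableSet.compl]; simp [hp]
        simp [ν, hsupp, this]
      have hint : ∀ f : EuclideanSpace ℝ (Fin n) → ℝ, Continuous f →
          ∫ x, f x ∂ν = (1 - t) * ∫ x, f x ∂μs + t * f p := by
        intro f hf
        have i1 := aux_int hΩc μs hsupp f hf
        have i2 : Integrable f (Measure.dirac p) := integrable_dirac (by simp)
        simp only [ν]
        rw [integral_add_measure (i1.smul_measure (by simp)) (i2.smul_measure (by simp)),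
          integral_smul_measure, integral_smul_measure, integral_dirac,
          ENNReal.toReal_ofReal t1', ENNReal.toReal_ofReal t0.le]
        simp
      have hm := hmax ν hν hνs
      rw [hres ν hνs, hres μs hsupp] at hm
      have e1 : ∀ y, ∫ x, ‖x - y‖ ∂ν = (1 - t) * U y + t * ‖p - y‖ :=
        fun y => hint (fun x => ‖x - y‖) (by fun_prop)
      simp only [e1] at hm
      rw [hint _ (by fun_prop)] at hm
      rw [integral_add ((aux_int hΩc μs hsupp U hUc).const_mul _)
        ((aux_int hΩc μs hsupp (fun y => ‖p - y‖) (by fun_prop)).const_mul _),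
        integral_const_mul, integral_const_mul] at hm
      have e2 : ∫ y, ‖p - y‖ ∂μs = U p := by
        simp only [hU]; congr 1; ext y; exact norm_sub_rev _ _
      rw [e2] at hm
      simpa using hm
    by_contra! hlt
    have hUp : 0 < U p := lt_of_le_of_lt hI0 hlt
    have q := quad ((U p - I) / (2 * U p)) (by apply div_pos <;> linarith)
      (by rw [div_lt_one (by linarith)]; linarith)
    set t := (U p - I) / (2 * U p) with ht
    have htU : t * (2 * U p) = U p - I := by rw [ht]; field_simp
    have t0 : 0 < t := by rw [ht]; apply div_pos <;> linarith
    have : t * (2 * (U p - I) - t * (2 * U p) + t * I) ≤ 0 := by nlinarith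
    have h2 : 0 < 2 * (U p - I) - t * (2 * U p) + t * I := by
      rw [htU]; nlinarith [mul_nonneg t0.le hI0]
    nlinarith [mul_pos t0 h2]
  intro x0 hx0
  have hx0' : ∀ V : Set (EuclideanSpace ℝ (Fin n)), IsOpen V → x0 ∈ V → 0 < μs V := hx0
  have hclos : x0 ∈ Ω := by
    by_contra hh
    exact absurd hsupp (hx0' _ hΩc.isClosed.isOpen_compl hh).ne'
  have pos : ∀ f : EuclideanSpace ℝ (Fin n) → ℝ, Continuous f → (∀ᵐ y ∂μs, 0 ≤ f y) →
      0 < f x0 → 0 < ∫ y, f y ∂μs := by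
    intro f hf h0 hp
    rw [integral_pos_iff_support_of_nonneg_ae h0 (aux_int hΩc μs hsupp f hf)]
    refine hx0' _ ?_ hp.ne'
    exact isOpen_ne_fun hf continuous_const
  have hUx0 : I ≤ U x0 := by
    by_contra! hlt
    have := pos (fun y => I - U y) (by fun_prop)
      (by filter_upwards [hae] with y hy using sub_nonneg.2 (key y hy)) (sub_pos.2 hlt)
    rw [integral_sub (integrable_const _) (aux_int hΩc μs hsupp U hUc)] at this
    simp [← hI] at this
  rw [hΩc.isClosed.frontier_eq]
  refine ⟨hclos, fun hint => ?_⟩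
  obtain ⟨r, r0, hr⟩ := Metric.mem_nhds_iff.1 (mem_interior_iff_mem_nhds.1 hint)
  obtain ⟨v, hv⟩ : ∃ v : EuclideanSpace ℝ (Fin n), ‖v‖ = r / 2 := by
    refine ⟨EuclideanSpace.single ⟨0, hn⟩ (r / 2), ?_⟩
    rw [EuclideanSpace.norm_single, Real.norm_of_nonneg (by linarith)]
  have ha := key (x0 + v) (hr (by simp [hv]; linarith))
  have hb := key (x0 - v) (hr (by simp [dist_eq_norm, hv]; linarith))
  have hp := pos (fun y => ‖y - (x0 + v)‖ + ‖y - (x0 - v)‖ - 2 * ‖y - x0‖) (by fun_prop)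
    (Filter.Eventually.of_forall fun y => by
      have := norm_add_le (y - (x0 + v)) (y - (x0 - v))
      have e : y - (x0 + v) + (y - (x0 - v)) = (2 : ℝ) • (y - x0) := by module
      rw [e, norm_smul] at this
      simp only [Real.norm_ofNat] at this
      simpa using this)
    (by simp [hv]; linarith)
  have i1 := aux_int hΩc μs hsupp (fun y => ‖y - (x0 + v)‖) (by fun_prop)
  have i2 := aux_int hΩc μs hsupp (fun y => ‖y - (x0 - v)‖) (by fun_prop)
  have i3 := aux_int hΩc μs hsupp (fun y => ‖y - x0‖) (by fun_prop)
  have i12 : Integrable (fun y => ‖y - (x0 + v)‖ + ‖y - (x0 - v)‖) μs := i1.add i2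
  rw [integral_sub i12 (i3.const_mul 2), integral_add i1 i2, integral_const_mul] at hp
  change 0 < U (x0 + v) + U (x0 - v) - 2 * U x0 at hp
  linarith
end

section
/- Let n ≥ 1 and let Ω ⊆ ℝⁿ be a nonempty compact set. Then the Borel probability measure on Ω maximizing I(μ) = ∫_Ω ∫_Ω ‖x − y‖ dμ(x) dμ(y) is unique: if μ₁ and μ₂ are Borel probability measures on Ω with I(μ) ≤ I(μ₁) and I(μ) ≤ I(μ₂) for every Borel probability measure μ on Ω, then μ₁ = μ₂. -/
open MeasureTheory

namespace Bj

local notation "E" n => EuclideanSpace ℝ (Fin n)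

noncomputable def w (n : ℕ) (ξ : E n) : ℝ := (‖ξ‖ ^ (n + 1))⁻¹

lemma w_nonneg (n : ℕ) (ξ : E n) : 0 ≤ w n ξ := by unfold w; positivity

lemma w_meas (n : ℕ) : Measurable (w n) := by unfold w; fun_prop

noncomputable def h (n : ℕ) (v ξ : E n) : ℝ := (1 - Real.cos (inner ℝ v ξ)) * w n ξ

noncomputable def q (n : ℕ) (ξ : E n) : ℝ := ‖ξ‖ ^ 2 * (1 + ‖ξ‖ ^ 2)⁻¹ * w n ξ

lemma q_int (n : ℕ) (hn : 1 ≤ n) : Integrable (q n) := by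
  have : Nonempty (Fin n) := ⟨⟨0, hn⟩⟩
  have := (integrable_fun_norm_addHaar (volume : Measure (E n))
    (f := fun r : ℝ => r ^ 2 * (1 + r ^ 2)⁻¹ * (r ^ (n + 1))⁻¹)).2 ?_
  · exact this
  · refine (integrable_inv_one_add_sq.integrableOn (s := Set.Ioi 0)).congr_fun ?_ measurableSet_Ioi
    intro r hr
    have hr : 0 < r := hr
    obtain ⟨m, rfl⟩ : ∃ m, n = m + 1 := ⟨n - 1, by omega⟩
    simp only [finrank_euclideanSpace, Fintype.card_fin, Nat.add_sub_cancel, smul_eq_mul]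
    field_simp
    ring

lemma h_nonneg (n : ℕ) (v ξ : E n) : 0 ≤ h n v ξ :=
  mul_nonneg (by linarith [Real.cos_le_one (inner ℝ v ξ)]) (w_nonneg n ξ)

lemma h_le (n : ℕ) (v ξ : E n) : h n v ξ ≤ (2 + ‖v‖ ^ 2 / 2) * q n ξ := by
  have hc : 1 - Real.cos (inner ℝ v ξ) ≤ ‖v‖ ^ 2 * ‖ξ‖ ^ 2 / 2 := by
    have h1 := Real.one_sub_sq_div_two_le_cos (x := inner ℝ v ξ)
    have h2 : (inner ℝ v ξ : ℝ) ^ 2 ≤ ‖v‖ ^ 2 * ‖ξ‖ ^ 2 := by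
      rw [← mul_pow]
      exact sq_le_sq' (by linarith [neg_le_of_abs_le (abs_real_inner_le_norm v ξ)])
        (real_inner_le_norm v ξ)
    linarith
  have h2 := Real.neg_one_le_cos (inner ℝ v ξ)
  have key : 1 - Real.cos (inner ℝ v ξ) ≤ (2 + ‖v‖ ^ 2 / 2) * (‖ξ‖ ^ 2 * (1 + ‖ξ‖ ^ 2)⁻¹) := by
    rw [← div_eq_mul_inv, ← mul_div_assoc, le_div_iff₀ (by positivity)]
    nlinarith [sq_nonneg ‖ξ‖]
  unfold h q
  rw [← mul_assoc]
  exact mul_le_mul_of_nonneg_right key (w_nonneg n ξ)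

noncomputable def F (n : ℕ) (v : E n) : ℝ := ∫ ξ, h n v ξ

lemma F_nonneg (n : ℕ) (v : E n) : 0 ≤ F n v := integral_nonneg (h_nonneg n v)

lemma F_rot (n : ℕ) (v v' : E n) (hv : ‖v‖ = ‖v'‖) : F n v = F n v' := by
  set R := (Submodule.reflection (Submodule.span ℝ {v - v'})ᗮ)
  have hR : R v = v' := Submodule.reflection_sub hv
  unfold F
  rw [← (R.measurePreserving).integral_comp R.toHomeomorph.measurableEmbedding (h n v')]
  congr 1; ext ξ
  rw [← hR]
  simp [h, w]

lemma F_scale (n : ℕ) (v : E n) (a : ℝ) (ha : 0 ≤ a) : F n (a • v) = a * F n v := by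
  rcases ha.eq_or_lt with rfl | ha
  · simp [F, h]
  have := Measure.integral_comp_smul_of_nonneg (volume : Measure (E n)) (h n v) a (hR := ha.le)
  unfold F
  have e : ∀ ξ, h n (a • v) ξ = a ^ (n + 1) * h n v (a • ξ) := by
    intro ξ
    simp only [h, w, inner_smul_left, inner_smul_right, norm_smul, Real.norm_eq_abs, abs_of_pos ha,
      mul_pow, mul_inv]
    simp
    field_simp
  simp_rw [e]
  rw [integral_const_mul, this]
  simp
  field_simp
  ring

lemma F_eq (n : ℕ) (hn : 1 ≤ n) : ∃ K, 0 ≤ K ∧ ∀ v : E n, F n v = K * ‖v‖ := by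
  refine ⟨F n (EuclideanSpace.single ⟨0, hn⟩ 1), F_nonneg _ _, fun v => ?_⟩
  rw [mul_comm, ← F_scale _ _ _ (norm_nonneg v)]
  apply F_rot
  simp [norm_smul]

lemma h_meas (n : ℕ) : Measurable (fun p : ((E n) × (E n)) × (E n) => h n (p.1.1 - p.1.2) p.2) := by
  unfold h
  have := w_meas n
  fun_prop

lemma ae_bd (n : ℕ) (Ω : Set (E n)) (hΩ : IsCompact Ω) : ∃ R : ℝ, ∀ α β : Measure (E n),
    IsProbabilityMeasure α → IsProbabilityMeasure β → α Ωᶜ = 0 → β Ωᶜ = 0 →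
    ∀ᵐ p ∂(α.prod β), ‖p.1 - p.2‖ ≤ R := by
  obtain ⟨C, hC⟩ := hΩ.isBounded.exists_norm_le
  refine ⟨C + C, fun α β _ _ ha hb => ?_⟩
  have ha : ∀ᵐ x ∂α, x ∈ Ω := ha
  have hb : ∀ᵐ x ∂β, x ∈ Ω := hb
  filter_upwards [Measure.quasiMeasurePreserving_fst.ae ha,
    Measure.quasiMeasurePreserving_snd.ae hb] with p h1 h2
  exact (norm_sub_le _ _).trans (add_le_add (hC _ h1) (hC _ h2))

lemma norm_int (n : ℕ) (α β : Measure (E n)) [IsProbabilityMeasure α] [IsProbabilityMeasure β]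
    (R : ℝ) (hR : ∀ᵐ p ∂(α.prod β), ‖p.1 - p.2‖ ≤ R) :
    Integrable (fun p : (E n) × (E n) => ‖p.1 - p.2‖) (α.prod β) := by
  refine Integrable.mono' (integrable_const R) (by fun_prop) ?_
  simpa using hR

lemma h_int (n : ℕ) (hn : 1 ≤ n) (α β : Measure (E n)) [IsProbabilityMeasure α]
    [IsProbabilityMeasure β]
    (R : ℝ) (hR : ∀ᵐ p ∂(α.prod β), ‖p.1 - p.2‖ ≤ R) :
    Integrable (fun p : ((E n) × (E n)) × (E n) => h n (p.1.1 - p.1.2) p.2)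
      ((α.prod β).prod volume) := by
  have hq := ((integrable_const (μ := α.prod β) (2 + R ^ 2 / 2)).mul_prod (q_int n hn))
  refine hq.mono' (h_meas n).aestronglyMeasurable ?_
  filter_upwards [Measure.quasiMeasurePreserving_fst.ae hR] with p hp
  rw [Real.norm_of_nonneg (h_nonneg _ _ _)]
  refine (h_le _ _ _).trans ?_
  have : 0 ≤ q n p.2 := mul_nonneg (by positivity) (w_nonneg _ _)
  gcongr

lemma inner_eq (n : ℕ) (α β : Measure (E n)) [IsProbabilityMeasure α]
    [IsProbabilityMeasure β] (ξ : E n) :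
    ∫ p, h n (p.1 - p.2) ξ ∂(α.prod β) =
      (1 - (charFun α ξ * (starRingEnd ℂ) (charFun β ξ)).re) * w n ξ := by
  unfold h
  rw [integral_mul_const]
  congr 1
  have hi : Integrable (fun p : (E n) × (E n) =>
      Complex.exp ((inner ℝ p.1 ξ : ℝ) * Complex.I) * Complex.exp ((inner ℝ p.2 (-ξ) : ℝ) * Complex.I))
      (α.prod β) := by
    refine Integrable.mono' (integrable_const 1) (by fun_prop) ?_
    refine .of_forall fun p => ?_
    rw [norm_mul, Complex.norm_exp_ofReal_mul_I, Complex.norm_exp_ofReal_mul_I, one_mul]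
  have hre : ∀ p : (E n) × (E n), Real.cos (inner ℝ (p.1 - p.2) ξ) =
      RCLike.re (Complex.exp ((inner ℝ p.1 ξ : ℝ) * Complex.I) *
        Complex.exp ((inner ℝ p.2 (-ξ) : ℝ) * Complex.I)) := by
    intro p
    rw [← Complex.exp_add, ← add_mul, ← Complex.ofReal_add, inner_neg_right, ← sub_eq_add_neg,
      ← inner_sub_left]
    exact (Complex.exp_ofReal_mul_I_re _).symm
  simp_rw [hre]
  rw [integral_sub (integrable_const _) hi.re, integral_re hi,
    integral_prod_mul (fun x => Complex.exp ((inner ℝ x ξ : ℝ) * Complex.I))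
      (fun x => Complex.exp ((inner ℝ x (-ξ) : ℝ) * Complex.I)), ← charFun_neg, charFun_apply,
    charFun_apply]
  simp

/-- Energy in the iterated form used in the statement. -/
noncomputable def J (n : ℕ) (α β : Measure (E n)) : ℝ := ∫ y, ∫ x, ‖x - y‖ ∂α ∂β

lemma J_eq (n : ℕ) (α β : Measure (E n)) [IsProbabilityMeasure α] [IsProbabilityMeasure β]
    (R : ℝ) (hR : ∀ᵐ p ∂(α.prod β), ‖p.1 - p.2‖ ≤ R) :
    J n α β = ∫ p, ‖p.1 - p.2‖ ∂(α.prod β) :=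
  (integral_prod_symm _ (norm_int n α β R hR)).symm

lemma KJ (n : ℕ) (hn : 1 ≤ n) (K : ℝ) (hK : ∀ v : E n, F n v = K * ‖v‖) (α β : Measure (E n))
    [IsProbabilityMeasure α] [IsProbabilityMeasure β]
    (R : ℝ) (hR : ∀ᵐ p ∂(α.prod β), ‖p.1 - p.2‖ ≤ R) :
    Integrable (fun ξ => (1 - (charFun α ξ * (starRingEnd ℂ) (charFun β ξ)).re) * w n ξ) ∧
    K * J n α β = ∫ ξ, (1 - (charFun α ξ * (starRingEnd ℂ) (charFun β ξ)).re) * w n ξ := by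
  have hi := h_int n hn α β R hR
  simp_rw [← inner_eq]
  refine ⟨hi.integral_prod_right, ?_⟩
  rw [J_eq n α β R hR, ← integral_const_mul]
  simp_rw [← hK, F]
  exact integral_integral_swap hi

lemma mid (n : ℕ) (μ₁ μ₂ : Measure (E n)) [IsProbabilityMeasure μ₁] [IsProbabilityMeasure μ₂]
    (R : ℝ)
    (h11 : ∀ᵐ p ∂(μ₁.prod μ₁), ‖p.1 - p.2‖ ≤ R) (h12 : ∀ᵐ p ∂(μ₁.prod μ₂), ‖p.1 - p.2‖ ≤ R)
    (h21 : ∀ᵐ p ∂(μ₂.prod μ₁), ‖p.1 - p.2‖ ≤ R) (h22 : ∀ᵐ p ∂(μ₂.prod μ₂), ‖p.1 - p.2‖ ≤ R) :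
    J n ((2 : ENNReal)⁻¹ • (μ₁ + μ₂)) ((2 : ENNReal)⁻¹ • (μ₁ + μ₂)) =
      (J n μ₁ μ₁ + J n μ₁ μ₂ + J n μ₂ μ₁ + J n μ₂ μ₂) / 4 := by
  have i11 := norm_int n _ _ R h11
  have i12 := norm_int n _ _ R h12
  have i21 := norm_int n _ _ R h21
  have i22 := norm_int n _ _ R h22
  have g11 := i11.integral_prod_right
  have g12 := i12.integral_prod_right
  have g21 := i21.integral_prod_right
  have g22 := i22.integral_prod_right
  have a1 : ∀ᵐ y ∂μ₁, ∫ x, ‖x - y‖ ∂(μ₁ + μ₂) = ∫ x, ‖x - y‖ ∂μ₁ + ∫ x, ‖x - y‖ ∂μ₂ := by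
    filter_upwards [i11.prod_left_ae, i21.prod_left_ae] with y h1 h2
    exact integral_add_measure h1 h2
  have a2 : ∀ᵐ y ∂μ₂, ∫ x, ‖x - y‖ ∂(μ₁ + μ₂) = ∫ x, ‖x - y‖ ∂μ₁ + ∫ x, ‖x - y‖ ∂μ₂ := by
    filter_upwards [i12.prod_left_ae, i22.prod_left_ae] with y h1 h2
    exact integral_add_measure h1 h2
  unfold J
  simp_rw [integral_smul_measure]
  rw [integral_smul, integral_add_measure ((g11.add g21).congr (a1.mono fun y hy => hy.symm))
    ((g12.add g22).congr (a2.mono fun y hy => hy.symm)), integral_congr_ae a1, integral_congr_ae a2,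
    integral_add g11 g21, integral_add g12 g22]
  simp
  ring

end Bj

/-- **Björck, uniqueness.** For a nonempty compact `Ω ⊆ ℝⁿ`, the probability measure
maximizing the energy `I(μ) = ∫_Ω ∫_Ω ‖x - y‖ dμ(x) dμ(y)` is unique. -/
theorem stmt_9 (n : ℕ) (hn : 1 ≤ n) (Ω : Set (EuclideanSpace ℝ (Fin n)))
    (hΩc : IsCompact Ω) (hΩne : Ω.Nonempty)
    (μ₁ μ₂ : Measure (EuclideanSpace ℝ (Fin n)))
    (hμ₁ : IsProbabilityMeasure μ₁) (hμ₂ : IsProbabilityMeasure μ₂)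
    (hsupp₁ : μ₁ Ωᶜ = 0) (hsupp₂ : μ₂ Ωᶜ = 0)
    (hmax₁ : ∀ μ : Measure (EuclideanSpace ℝ (Fin n)), IsProbabilityMeasure μ → μ Ωᶜ = 0 →
      (∫ y in Ω, ∫ x in Ω, ‖x - y‖ ∂μ ∂μ) ≤ ∫ y in Ω, ∫ x in Ω, ‖x - y‖ ∂μ₁ ∂μ₁)
    (hmax₂ : ∀ μ : Measure (EuclideanSpace ℝ (Fin n)), IsProbabilityMeasure μ → μ Ωᶜ = 0 →
      (∫ y in Ω, ∫ x in Ω, ‖x - y‖ ∂μ ∂μ) ≤ ∫ y in Ω, ∫ x in Ω, ‖x - y‖ ∂μ₂ ∂μ₂) :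
    μ₁ = μ₂ := by
  classical
  obtain ⟨R, hR⟩ := Bj.ae_bd n Ω hΩc
  obtain ⟨K, hK0, hK⟩ := Bj.F_eq n hn
  have r : ∀ μ : Measure (EuclideanSpace ℝ (Fin n)), μ Ωᶜ = 0 →
      (∫ y in Ω, ∫ x in Ω, ‖x - y‖ ∂μ ∂μ) = Bj.J n μ μ := by
    intro μ hμ
    rw [Measure.restrict_eq_self_of_ae_mem (s := Ω) hμ]
    rfl
  have b11 := hR μ₁ μ₁ hμ₁ hμ₁ hsupp₁ hsupp₁
  have b12 := hR μ₁ μ₂ hμ₁ hμ₂ hsupp₁ hsupp₂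
  have b21 := hR μ₂ μ₁ hμ₂ hμ₁ hsupp₂ hsupp₁
  have b22 := hR μ₂ μ₂ hμ₂ hμ₂ hsupp₂ hsupp₂
  have m1 := hmax₁ μ₂ hμ₂ hsupp₂
  have m2 := hmax₂ μ₁ hμ₁ hsupp₁
  have z : ((2 : ENNReal)⁻¹ • (μ₁ + μ₂)) Ωᶜ = 0 := by simp [hsupp₁, hsupp₂]
  have m3 := hmax₁ ((2 : ENNReal)⁻¹ • (μ₁ + μ₂)) ⟨by
    simp [ENNReal.inv_two_add_inv_two]⟩ z
  rw [r _ z, r _ hsupp₁, Bj.mid n μ₁ μ₂ R b11 b12 b21 b22] at m3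
  rw [r _ hsupp₁, r _ hsupp₂] at m1 m2
  obtain ⟨i11, k11⟩ := Bj.KJ n hn K hK μ₁ μ₁ R b11
  obtain ⟨i12, k12⟩ := Bj.KJ n hn K hK μ₁ μ₂ R b12
  obtain ⟨i21, k21⟩ := Bj.KJ n hn K hK μ₂ μ₁ R b21
  obtain ⟨i22, k22⟩ := Bj.KJ n hn K hK μ₂ μ₂ R b22
  have id : ∀ ξ, Complex.normSq (charFun μ₁ ξ - charFun μ₂ ξ) * Bj.w n ξ =
      ((1 - (charFun μ₁ ξ * (starRingEnd ℂ) (charFun μ₂ ξ)).re) * Bj.w n ξ +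
      (1 - (charFun μ₂ ξ * (starRingEnd ℂ) (charFun μ₁ ξ)).re) * Bj.w n ξ) -
      ((1 - (charFun μ₁ ξ * (starRingEnd ℂ) (charFun μ₁ ξ)).re) * Bj.w n ξ +
      (1 - (charFun μ₂ ξ * (starRingEnd ℂ) (charFun μ₂ ξ)).re) * Bj.w n ξ) := by
    intro ξ
    simp [Complex.normSq_apply]
    ring
  have hint : Integrable (fun ξ => Complex.normSq (charFun μ₁ ξ - charFun μ₂ ξ) * Bj.w n ξ) := by
    simp_rw [id]
    exact (i12.add i21).sub (i11.add i22)
  have hnn : ∀ ξ, 0 ≤ Complex.normSq (charFun μ₁ ξ - charFun μ₂ ξ) * Bj.w n ξ :=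
    fun ξ => mul_nonneg (Complex.normSq_nonneg _) (Bj.w_nonneg n ξ)
  have hle : ∫ ξ, Complex.normSq (charFun μ₁ ξ - charFun μ₂ ξ) * Bj.w n ξ ≤ 0 := by
    simp_rw [id]
    rw [integral_sub (by exact i12.add i21) (by exact i11.add i22), integral_add i12 i21, integral_add i11 i22,
      ← k11, ← k12, ← k21, ← k22]
    have : 0 ≤ K * (Bj.J n μ₁ μ₁ + Bj.J n μ₂ μ₂ - Bj.J n μ₁ μ₂ - Bj.J n μ₂ μ₁) :=
      mul_nonneg hK0 (by linarith)
    linarith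
  have h0 := (integral_eq_zero_iff_of_nonneg hnn hint).1 (le_antisymm hle (integral_nonneg hnn))
  apply Measure.ext_of_charFun
  refine (Continuous.ae_eq_iff_eq volume continuous_charFun continuous_charFun).1 ?_
  filter_upwards [h0] with ξ hξ
  rcases mul_eq_zero.1 hξ with h | h
  · exact sub_eq_zero.1 (Complex.normSq_eq_zero.1 h)
  · have : ξ = 0 := by simpa [Bj.w] using h
    subst this
    simp [charFun_zero]
end

section
/- Let n ≥ 1, let Ω ⊆ ℝⁿ be a nonempty compact set, and let μ* be a Borel probability measure on Ω maximizing I(μ) = ∫_Ω ∫_Ω ‖x − y‖ dμ(x) dμ(y) over all Borel probability measures on Ω. If the support of μ* equals the topological boundary ∂Ω of Ω, then ∫_Ω ‖x − y‖ dμ*(y) = I(μ*) for every x ∈ ∂Ω; in particular x ↦ ∫ ‖x − y‖ dμ*(y) is constant on ∂Ω. -/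
open MeasureTheory

/-- **Corollary 1.** If the maximizer `μ*` of the energy
`I(μ) = ∫_Ω ∫_Ω ‖x - y‖ dμ(x) dμ(y)` over probability measures on a nonempty compact
`Ω ⊆ ℝⁿ` has support equal to the frontier of `Ω`, then `x ↦ ∫_Ω ‖x - y‖ dμ*(y)` equals
`I(μ*)` (in particular is constant) on the frontier of `Ω`. -/
theorem stmt_10 (n : ℕ) (hn : 1 ≤ n) (Ω : Set (EuclideanSpace ℝ (Fin n)))
    (hΩc : IsCompact Ω) (hΩne : Ω.Nonempty)
    (μs : Measure (EuclideanSpace ℝ (Fin n))) (hμs : IsProbabilityMeasure μs)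
    (hsupp : μs Ωᶜ = 0)
    (hmax : ∀ μ : Measure (EuclideanSpace ℝ (Fin n)), IsProbabilityMeasure μ → μ Ωᶜ = 0 →
      (∫ y in Ω, ∫ x in Ω, ‖x - y‖ ∂μ ∂μ) ≤ ∫ y in Ω, ∫ x in Ω, ‖x - y‖ ∂μs ∂μs)
    (hdense : measureSupport μs = frontier Ω) :
    ∀ x ∈ frontier Ω,
      (∫ y in Ω, ‖x - y‖ ∂μs) = ∫ y in Ω, ∫ x in Ω, ‖x - y‖ ∂μs ∂μs := by
  have hm : MeasurableSet Ω := hΩc.isClosed.measurableSet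
  have hres : ∀ μ : Measure (EuclideanSpace ℝ (Fin n)), μ Ωᶜ = 0 → μ.restrict Ω = μ := by
    intro μ h
    exact Measure.restrict_eq_self_of_ae_mem (by rw [ae_iff]; exact h)
  have hint : ∀ f : EuclideanSpace ℝ (Fin n) → ℝ, Continuous f → Integrable f μs := by
    intro f hf
    have := hf.continuousOn.integrableOn_compact (μ := μs) hΩc
    rwa [IntegrableOn, hres μs hsupp] at this
  have hmax' : ∀ μ : Measure (EuclideanSpace ℝ (Fin n)), IsProbabilityMeasure μ → μ Ωᶜ = 0 →
      (∫ y, ∫ x, ‖x - y‖ ∂μ ∂μ) ≤ ∫ y, ∫ x, ‖x - y‖ ∂μs ∂μs := by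
    intro μ h1 h2
    have := hmax μ h1 h2
    rwa [hres μ h2, hres μs hsupp] at this
  rw [hres μs hsupp]
  clear hmax
  set U : EuclideanSpace ℝ (Fin n) → ℝ := fun y => ∫ x, ‖x - y‖ ∂μs with hU
  have hsymm : ∀ x, ∫ y, ‖x - y‖ ∂μs = U x := fun x => by
    simp only [hU, norm_sub_rev]
  have hUc : Continuous U := by
    refine (LipschitzWith.of_dist_le_mul (K := 1) ?_).continuous
    intro a b
    have h1 : U a - U b = ∫ x, (‖x - a‖ - ‖x - b‖) ∂μs :=
      (integral_sub (hint _ (by fun_prop)) (hint _ (by fun_prop))).symm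
    rw [Real.dist_eq, h1, ← Real.norm_eq_abs]
    refine (norm_integral_le_of_norm_le_const (C := dist a b) (ae_of_all _ fun x => ?_)).trans ?_
    · rw [Real.norm_eq_abs]
      refine (abs_norm_sub_norm_le _ _).trans (le_of_eq ?_)
      rw [dist_comm, dist_eq_norm]
      congr 1
      abel
    · simp
  set I : ℝ := ∫ y, U y ∂μs with hI
  have hle : ∀ x ∈ Ω, U x ≤ I := by
    intro x hx
    have key : ∀ t : ℝ, 0 < t → t < 1 → 2 * (1 - t) * U x ≤ (2 - t) * I := by
      intro t ht0 ht1
      set μ : Measure (EuclideanSpace ℝ (Fin n)) :=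
        ENNReal.ofReal (1 - t) • μs + ENNReal.ofReal t • Measure.dirac x with hμ
      have hp : IsProbabilityMeasure μ := by
        constructor
        simp only [hμ, Measure.add_apply, Measure.smul_apply, measure_univ, smul_eq_mul, mul_one]
        rw [← ENNReal.ofReal_add (by linarith) ht0.le]
        simp
      have h0 : μ Ωᶜ = 0 := by
        simp [hμ, hsupp, Measure.dirac_apply' _ hm.compl, hx]
      have hf : ∀ f : EuclideanSpace ℝ (Fin n) → ℝ, Continuous f →
          ∫ z, f z ∂μ = (1 - t) * (∫ z, f z ∂μs) + t * f x := by
        intro f hf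
        rw [hμ, integral_add_measure, integral_smul_measure, integral_smul_measure,
          integral_dirac, ENNReal.toReal_ofReal (by linarith), ENNReal.toReal_ofReal ht0.le]
        · simp
        · exact (hint f hf).smul_measure ENNReal.ofReal_ne_top
        · exact (integrable_dirac (by simp)).smul_measure ENNReal.ofReal_ne_top
      have h := hmax' μ hp h0
      have h2 : ∀ y, ∫ z, ‖z - y‖ ∂μ = (1 - t) * U y + t * ‖x - y‖ := fun y =>
        hf (fun z => ‖z - y‖) (by fun_prop)
      simp only [h2] at h
      rw [hf _ (by fun_prop), integral_add ((hint _ hUc).const_mul _)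
        ((hint (fun y => ‖x - y‖) (by fun_prop)).const_mul _), integral_const_mul,
        integral_const_mul, hsymm, ← hI] at h
      simp only [sub_self, norm_zero, mul_zero, add_zero] at h
      have : t * (2 * (1 - t) * U x) ≤ t * ((2 - t) * I) := by
        have h' : (1 - t) * ((1 - t) * I + t * U x) + t * ((1 - t) * U x) ≤ I := h
        nlinarith
      exact le_of_mul_le_mul_left this ht0
    by_contra hlt
    push Not at hlt
    have hU0 : 0 ≤ U x := integral_nonneg fun _ => norm_nonneg _
    have hI0 : 0 ≤ I := integral_nonneg fun _ => integral_nonneg fun _ => norm_nonneg _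
    have hUp : 0 < U x := lt_of_le_of_lt hI0 hlt
    have := key ((U x - I) / (2 * U x)) (by apply div_pos <;> linarith)
      (by rw [div_lt_one (by linarith)]; linarith)
    have he : (U x - I) / (2 * U x) * (2 * U x) = U x - I := div_mul_cancel₀ _ (by linarith)
    have hp : 0 < (U x - I) / (2 * U x) := by apply div_pos <;> linarith
    nlinarith
  have hae : ∀ᵐ y ∂μs, U y = I := by
    have h1 : ∀ᵐ y ∂μs, 0 ≤ I - U y := by
      have : ∀ᵐ y ∂μs, y ∈ Ω := by rw [ae_iff]; exact hsupp
      filter_upwards [this] with y hy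
      linarith [hle y hy]
    have h2 : ∫ y, (I - U y) ∂μs = 0 := by
      rw [integral_sub (integrable_const _) (hint U hUc)]
      simp [hI]
    have h3 := (integral_eq_zero_iff_of_nonneg_ae h1 (hint _ (by fun_prop))).1 h2
    filter_upwards [h3] with y hy
    simp only [Pi.zero_apply] at hy
    linarith
  intro x hx
  rw [hsymm]
  by_contra hne
  rw [← hdense] at hx
  have := hx {y | U y ≠ I} (isOpen_ne_fun hUc continuous_const) hne
  rw [ae_iff] at hae
  exact this.ne' hae
end

section
/- Let n ≥ 1 be a natural number and let κ : ℝ → ℝ be continuous with κ(ξ) ≥ 1 − 1/n for all ξ ∈ [0, 2π] and ∫₀^{2π} κ(ξ) dξ = 2π. Define x(s) = ∫₀^s cos(∫₀^τ κ(ξ) dξ) dτ and y(s) = ∫₀^s sin(∫₀^τ κ(ξ) dξ) dτ. Then for all s ∈ [0, 2π]: |x(s) − sin(s)| ≤ 8π²/n and |y(s) − (1 − cos(s))| ≤ 8π²/n. -/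
open Real intervalIntegral

theorem aux_theta (c : ℝ) (κ : ℝ → ℝ) (hκ : Continuous κ) (hc : 0 ≤ c)
    (hlow : ∀ ξ ∈ Set.Icc (0 : ℝ) (2 * π), 1 - c ≤ κ ξ)
    (htotal : ∫ ξ in (0 : ℝ)..(2 * π), κ ξ = 2 * π) (τ : ℝ)
    (h0 : 0 ≤ τ) (h1 : τ ≤ 2 * π) :
    |(∫ ξ in (0 : ℝ)..τ, κ ξ) - τ| ≤ 2 * π * c := by
  have hi : ∀ a b : ℝ, IntervalIntegrable κ MeasureTheory.volume a b :=
    fun a b => hκ.intervalIntegrable a b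
  have hsum := integral_add_adjacent_intervals (hi 0 τ) (hi τ (2 * π))
  have l1 : ∫ ξ in (0 : ℝ)..τ, (1 - c) ≤ ∫ ξ in (0 : ℝ)..τ, κ ξ :=
    integral_mono_on h0 (by simp) (hi _ _)
      (fun ξ hξ => hlow ξ ⟨hξ.1, hξ.2.trans h1⟩)
  have l2 : ∫ ξ in τ..(2 * π), (1 - c) ≤ ∫ ξ in τ..(2 * π), κ ξ :=
    integral_mono_on h1 (by simp) (hi _ _)
      (fun ξ hξ => hlow ξ ⟨h0.trans hξ.1, hξ.2⟩)
  rw [integral_const, smul_eq_mul] at l1 l2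
  rw [abs_le]
  constructor <;> nlinarith [mul_nonneg h0 hc, mul_nonneg (sub_nonneg.2 h1) hc]

theorem aux_int_s11 (c : ℝ) (hc : 0 ≤ c) (θ f : ℝ → ℝ) (hθ : Continuous θ) (hf : Continuous f)
    (hL : ∀ a b, |f a - f b| ≤ |a - b|)
    (h : ∀ τ, 0 ≤ τ → τ ≤ 2 * π → |θ τ - τ| ≤ 2 * π * c) (s : ℝ)
    (h0 : 0 ≤ s) (h1 : s ≤ 2 * π) :
    |(∫ τ in (0 : ℝ)..s, f (θ τ)) - ∫ τ in (0 : ℝ)..s, f τ| ≤ 8 * π ^ 2 * c := by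
  have hc1 : Continuous fun τ => f (θ τ) := hf.comp hθ
  rw [← integral_sub (hc1.intervalIntegrable _ _) (hf.intervalIntegrable _ _)]
  have := norm_integral_le_of_norm_le_const (a := 0) (b := s) (C := 2 * π * c)
    (f := fun τ => f (θ τ) - f τ) (by
      intro τ hτ
      rw [Set.uIoc_of_le h0] at hτ
      exact (hL _ _).trans (h τ hτ.1.le (hτ.2.trans h1)))
  rw [Real.norm_eq_abs, sub_zero, abs_of_nonneg h0] at this
  refine this.trans ?_
  have hp : 0 ≤ 2 * π * c := by positivity
  nlinarith [mul_le_mul_of_nonneg_left h1 hp, mul_nonneg (sq_nonneg π) hc]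

theorem aux_cos_s11 (a b : ℝ) : |cos a - cos b| ≤ |a - b| := by
  have := Real.lipschitzWith_cos.dist_le_mul a b
  simpa [Real.dist_eq] using this

theorem aux_sin_s11 (a b : ℝ) : |sin a - sin b| ≤ |a - b| := by
  have := Real.lipschitzWith_sin.dist_le_mul a b
  simpa [Real.dist_eq] using this

/-- **Lemma (curve close to circle).** If `κ` is continuous with `κ ≥ 1 - 1/n` on
`[0, 2π]` and total integral `2π`, then the curve
`(x(s), y(s)) = (∫₀^s cos(∫₀^τ κ) dτ, ∫₀^s sin(∫₀^τ κ) dτ)` is within `8π²/n` of the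
unit circle parametrization `(sin s, 1 - cos s)` in each coordinate. -/
theorem stmt_11 (n : ℕ) (hn : 1 ≤ n) (κ : ℝ → ℝ) (hκ : Continuous κ)
    (hlow : ∀ ξ ∈ Set.Icc (0 : ℝ) (2 * π), 1 - 1 / (n : ℝ) ≤ κ ξ)
    (htotal : ∫ ξ in (0 : ℝ)..(2 * π), κ ξ = 2 * π)
    (x y : ℝ → ℝ)
    (hx : ∀ s : ℝ, x s = ∫ τ in (0 : ℝ)..s, Real.cos (∫ ξ in (0 : ℝ)..τ, κ ξ))
    (hy : ∀ s : ℝ, y s = ∫ τ in (0 : ℝ)..s, Real.sin (∫ ξ in (0 : ℝ)..τ, κ ξ)) :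
    ∀ s ∈ Set.Icc (0 : ℝ) (2 * π),
      |x s - Real.sin s| ≤ 8 * π ^ 2 / (n : ℝ) ∧
        |y s - (1 - Real.cos s)| ≤ 8 * π ^ 2 / (n : ℝ) := by
  intro s hs
  have hc : (0 : ℝ) ≤ 1 / n := by positivity
  have hθ : Continuous fun τ : ℝ => ∫ ξ in (0 : ℝ)..τ, κ ξ :=
    continuous_primitive (fun a b => hκ.intervalIntegrable a b) 0
  have h := aux_theta (1 / n) κ hκ hc hlow htotal
  have e : 8 * π ^ 2 / (n : ℝ) = 8 * π ^ 2 * (1 / n) := by ring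
  have A := aux_int_s11 _ hc _ cos hθ continuous_cos aux_cos_s11 h s hs.1 hs.2
  have B := aux_int_s11 _ hc _ sin hθ continuous_sin aux_sin_s11 h s hs.1 hs.2
  rw [integral_cos, sin_zero, sub_zero] at A
  rw [integral_sin, cos_zero] at B
  rw [hx, hy, e]
  exact ⟨A, B⟩
end

section
/- For all real numbers y₁, y₂ and all d > 0: √((y₁ − d)² + y₂²) + √((y₁ + d)² + y₂²) − 2·√(y₁² + y₂²) ≥ d² · y₂² / (((|y₁| + d)² + y₂²)^{3/2}). -/
theorem aux_nonneg (a y d : ℝ) (ha : 0 ≤ a) (hd : 0 < d) :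
    d ^ 2 * y ^ 2 / ((a + d) ^ 2 + y ^ 2) ^ ((3 : ℝ) / 2) ≤
    Real.sqrt ((a - d) ^ 2 + y ^ 2) + Real.sqrt ((a + d) ^ 2 + y ^ 2) -
        2 * Real.sqrt (a ^ 2 + y ^ 2) := by
  have hpos : 0 < (a + d) ^ 2 + y ^ 2 := by positivity
  have hpow : ((a + d) ^ 2 + y ^ 2) ^ ((3 : ℝ) / 2) = Real.sqrt ((a + d) ^ 2 + y ^ 2) ^ 3 := by
    rw [Real.sqrt_eq_rpow, ← Real.rpow_natCast _ 3, ← Real.rpow_mul hpos.le]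
    norm_num
  rw [hpow]
  have hAB : Real.sqrt ((a - d) ^ 2 + y ^ 2) ≤ Real.sqrt ((a + d) ^ 2 + y ^ 2) :=
    Real.sqrt_le_sqrt (by nlinarith [mul_nonneg ha hd.le])
  have hCB : Real.sqrt (a ^ 2 + y ^ 2) ≤ Real.sqrt ((a + d) ^ 2 + y ^ 2) :=
    Real.sqrt_le_sqrt (by nlinarith [mul_nonneg ha hd.le])
  have hA2 := Real.sq_sqrt (show 0 ≤ (a - d) ^ 2 + y ^ 2 by positivity)
  have hB2 := Real.sq_sqrt hpos.le
  have hC2 := Real.sq_sqrt (show 0 ≤ a ^ 2 + y ^ 2 by positivity)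
  have hA := Real.sqrt_nonneg ((a - d) ^ 2 + y ^ 2)
  have hB := Real.sqrt_pos.2 hpos
  have hC := Real.sqrt_nonneg (a ^ 2 + y ^ 2)
  generalize Real.sqrt ((a - d) ^ 2 + y ^ 2) = A at *
  generalize Real.sqrt ((a + d) ^ 2 + y ^ 2) = B at *
  generalize Real.sqrt (a ^ 2 + y ^ 2) = C at *
  have hPQ : (A * B) ^ 2 - (a ^ 2 + y ^ 2 - d ^ 2) ^ 2 = 4 * (d ^ 2 * y ^ 2) := by
    rw [mul_pow, hA2, hB2]; ring
  have habs : |a ^ 2 + y ^ 2 - d ^ 2| ≤ A * B :=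
    abs_le_of_sq_le_sq (by nlinarith [sq_nonneg (d * y)]) (by positivity)
  have hP : 0 ≤ A * B - (a ^ 2 + y ^ 2 - d ^ 2) := by linarith [(abs_le.1 habs).2]
  have hQ : A * B + (a ^ 2 + y ^ 2 - d ^ 2) ≤ 2 * B ^ 2 := by
    nlinarith [mul_le_mul_of_nonneg_right hAB hB.le, mul_nonneg ha hd.le, sq_nonneg d]
  have h1 : 2 * (d ^ 2 * y ^ 2) ≤ (A * B - (a ^ 2 + y ^ 2 - d ^ 2)) * B ^ 2 := by
    nlinarith [mul_le_mul_of_nonneg_left hQ hP]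
  have hS : (A + B - 2 * C) * (A + B + 2 * C) = 2 * (A * B - (a ^ 2 + y ^ 2 - d ^ 2)) := by
    linear_combination hA2 + hB2 - 4 * hC2
  have hS0 : 0 ≤ A + B - 2 * C := by
    by_contra hn
    push Not at hn
    nlinarith [mul_neg_of_neg_of_pos hn (show 0 < A + B + 2 * C by linarith)]
  have h2 : A * B - (a ^ 2 + y ^ 2 - d ^ 2) ≤ (A + B - 2 * C) * (2 * B) := by
    nlinarith [mul_le_mul_of_nonneg_left (show A + B + 2 * C ≤ 4 * B by linarith) hS0]
  rw [div_le_iff₀ (by positivity)]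
  nlinarith [mul_le_mul_of_nonneg_right h2 (sq_nonneg B)]

/-- **Second-difference lower bound.** For all reals `y₁, y₂` and `d > 0`,
`√((y₁-d)² + y₂²) + √((y₁+d)² + y₂²) - 2√(y₁² + y₂²) ≥ d²·y₂²/(((|y₁|+d)² + y₂²)^{3/2})`. -/
theorem stmt_13 (y₁ y₂ d : ℝ) (hd : 0 < d) :
    Real.sqrt ((y₁ - d) ^ 2 + y₂ ^ 2) + Real.sqrt ((y₁ + d) ^ 2 + y₂ ^ 2) -
        2 * Real.sqrt (y₁ ^ 2 + y₂ ^ 2) ≥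
      d ^ 2 * y₂ ^ 2 / ((|y₁| + d) ^ 2 + y₂ ^ 2) ^ ((3 : ℝ) / 2) := by
  rcases abs_cases y₁ with ⟨h, h0⟩ | ⟨h, h0⟩
  · rw [h]
    exact aux_nonneg y₁ y₂ d h0 hd
  · rw [h]
    have := aux_nonneg (-y₁) y₂ d (by linarith) hd
    rw [show (-y₁ - d) ^ 2 = (y₁ + d) ^ 2 by ring, neg_sq] at this
    rw [show (y₁ - d) ^ 2 = (-y₁ + d) ^ 2 by ring]
    linarith
end

section
/- Fix d > 0 and y₂ ∈ ℝ. The function g(y₁) = 2·√(y₁² + y₂²) − √((y₁ − d)² + y₂²) − √((y₁ + d)² + y₂²) is monotone nondecreasing in y₁ on the interval [d, ∞): for all d ≤ a ≤ b, g(a) ≤ g(b). -/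
lemma tangent_aux (c x y : ℝ) (hc : c ≠ 0) (hx : 0 ≤ x) (hy : 0 ≤ y) :
    y / √(y ^ 2 + c ^ 2) ≤ x / √(x ^ 2 + c ^ 2) + c ^ 2 / (√(x ^ 2 + c ^ 2)) ^ 3 * (y - x) := by
  have hk : 0 < c ^ 2 := by positivity
  have hr : 0 < √(x ^ 2 + c ^ 2) := by positivity
  have hs : 0 < √(y ^ 2 + c ^ 2) := by positivity
  have hr2 : √(x ^ 2 + c ^ 2) ^ 2 = x ^ 2 + c ^ 2 := Real.sq_sqrt (by positivity)
  have hs2 : √(y ^ 2 + c ^ 2) ^ 2 = y ^ 2 + c ^ 2 := Real.sq_sqrt (by positivity)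
  set r := √(x ^ 2 + c ^ 2)
  set s := √(y ^ 2 + c ^ 2)
  have e : x / r + c ^ 2 / r ^ 3 * (y - x) = (x ^ 3 + c ^ 2 * y) / r ^ 3 := by
    have : x / r = x * r ^ 2 / r ^ 3 := by field_simp
    rw [this, hr2]; ring
  rw [e, div_le_div_iff₀ hs (by positivity)]
  refine (sq_le_sq₀ (by positivity) (by positivity)).1 ?_
  have e1 : (y * r ^ 3) ^ 2 = y ^ 2 * (x ^ 2 + c ^ 2) ^ 3 := by rw [← hr2]; ring
  have e2 : ((x ^ 3 + c ^ 2 * y) * s) ^ 2 = (x ^ 3 + c ^ 2 * y) ^ 2 * (y ^ 2 + c ^ 2) := by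
    rw [← hs2]; ring
  rw [e1, e2]
  have h1 : 0 ≤ c ^ 2 * (x ^ 3 * ((x - y) ^ 2 * (x + 2 * y))) := by positivity
  have h2 : 0 ≤ (c ^ 2) ^ 2 * (y * ((x - y) ^ 2 * (y + 2 * x))) := by positivity
  linarith

lemma hasDeriv_aux (c t : ℝ) (hc : c ≠ 0) (x : ℝ) :
    HasDerivAt (fun x : ℝ => √((x + t) ^ 2 + c ^ 2)) ((x + t) / √((x + t) ^ 2 + c ^ 2)) x := by
  have hk : 0 < c ^ 2 := by positivity
  have hp : 0 < (x + t) ^ 2 + c ^ 2 := by positivity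
  have h0 : HasDerivAt (fun x : ℝ => (x + t) ^ 2 + c ^ 2) (2 * (x + t)) x := by
    have h := (((hasDerivAt_id' x).add_const t).fun_pow 2).add_const (c ^ 2)
    have e : ((2 : ℕ) : ℝ) * (x + t) ^ (2 - 1) * 1 = 2 * (x + t) := by norm_num
    exact e ▸ h
  have h := h0.sqrt hp.ne'
  rwa [mul_div_mul_left _ _ two_ne_zero] at h

/-- **Monotonicity of the comparison function.** For fixed `d > 0` and `y₂ ∈ ℝ`, the
function `g(y₁) = 2√(y₁² + y₂²) - √((y₁-d)² + y₂²) - √((y₁+d)² + y₂²)` is monotone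
nondecreasing on `[d, ∞)`. -/
theorem stmt_14 (d y₂ : ℝ) (hd : 0 < d) (a b : ℝ) (ha : d ≤ a) (hab : a ≤ b) :
    2 * Real.sqrt (a ^ 2 + y₂ ^ 2) - Real.sqrt ((a - d) ^ 2 + y₂ ^ 2) -
        Real.sqrt ((a + d) ^ 2 + y₂ ^ 2) ≤
      2 * Real.sqrt (b ^ 2 + y₂ ^ 2) - Real.sqrt ((b - d) ^ 2 + y₂ ^ 2) -
        Real.sqrt ((b + d) ^ 2 + y₂ ^ 2) := by
  by_cases hc : y₂ = 0
  · subst hc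
    have z : ∀ x : ℝ, x ^ 2 + (0 : ℝ) ^ 2 = x ^ 2 := fun x => by ring
    simp only [z]
    rw [Real.sqrt_sq (by linarith), Real.sqrt_sq (by linarith), Real.sqrt_sq (by linarith),
      Real.sqrt_sq (by linarith), Real.sqrt_sq (by linarith), Real.sqrt_sq (by linarith)]
    linarith
  · have hD : ∀ x : ℝ, HasDerivAt (fun x : ℝ => 2 * √((x + 0) ^ 2 + y₂ ^ 2)
        - √((x + -d) ^ 2 + y₂ ^ 2) - √((x + d) ^ 2 + y₂ ^ 2))
        (2 * ((x + 0) / √((x + 0) ^ 2 + y₂ ^ 2)) - (x + -d) / √((x + -d) ^ 2 + y₂ ^ 2)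
          - (x + d) / √((x + d) ^ 2 + y₂ ^ 2)) x := fun x =>
      (((hasDeriv_aux y₂ 0 hc x).const_mul 2).sub (hasDeriv_aux y₂ (-d) hc x)).sub
        (hasDeriv_aux y₂ d hc x)
    have hm := monotoneOn_of_deriv_nonneg (convex_Ici d)
      (fun x _ => (hD x).continuousAt.continuousWithinAt)
      (fun x _ => (hD x).differentiableAt.differentiableWithinAt)
      (fun x hx => by
        rw [interior_Ici] at hx
        have hx' : d < x := hx
        rw [(hD x).deriv]
        have h1 := tangent_aux y₂ (x + 0) (x + -d) hc (by linarith) (by linarith)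
        have h2 := tangent_aux y₂ (x + 0) (x + d) hc (by linarith) (by linarith)
        linarith)
    have := hm (Set.mem_Ici.2 ha) (Set.mem_Ici.2 (ha.trans hab)) hab
    simpa only [add_zero, ← sub_eq_add_neg] using this
end

section
/- Let h : ℝ → ℝ be a C^∞, 2π-periodic function with h(t) + h''(t) > 0 for all t, and define γ(t) = (h(t)·cos(t) − h'(t)·sin(t), h(t)·sin(t) + h'(t)·cos(t)). Define F(t) = (1/(2π)) · ∫₀^{2π} ‖γ(t) − γ(s)‖ ds. Then sup_t F(t) − inf_t F(t) ≤ 4 · sup_t (|h(t) − 1| + |h'(t)|). -/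
open Real

/-- **Proposition 3 (curvature measure nearly solves the equation).** For a `C^∞`,
`2π`-periodic support function `h` with `h + h'' > 0`, the averaged distance
`F(t) = (1/2π) ∫₀^{2π} ‖γ(t) - γ(s)‖ ds` along
`γ(t) = (h cos t - h' sin t, h sin t + h' cos t)` satisfies
`sup F - inf F ≤ 4 sup (|h - 1| + |h'|)`. -/
theorem stmt_18 (h : ℝ → ℝ) (hh : ContDiff ℝ (⊤ : ℕ∞) h)
    (hper : Function.Periodic h (2 * π))
    (hpos : ∀ t : ℝ, 0 < h t + deriv (deriv h) t)
    (γ : ℝ → EuclideanSpace ℝ (Fin 2))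
    (hγ : ∀ t : ℝ, γ t = ![h t * Real.cos t - deriv h t * Real.sin t,
      h t * Real.sin t + deriv h t * Real.cos t])
    (F : ℝ → ℝ)
    (hF : ∀ t : ℝ, F t = (1 / (2 * π)) * ∫ s in (0 : ℝ)..(2 * π), ‖γ t - γ s‖) :
    (⨆ t : ℝ, F t) - (⨅ t : ℝ, F t) ≤ 4 * ⨆ t : ℝ, (|h t - 1| + |deriv h t|) := by
  set ε := ⨆ t : ℝ, (|h t - 1| + |deriv h t|) with hε
  have hd : Continuous (deriv h) := hh.continuous_deriv (by exact_mod_cast le_top)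
  have hc : Continuous h := hh.continuous
  have hdper : Function.Periodic (deriv h) (2 * π) := by
    intro t
    rw [← deriv_comp_add_const]
    congr 1
    funext x
    exact hper x
  have hbdd : BddAbove (Set.range fun t : ℝ => |h t - 1| + |deriv h t|) := by
    have hp : Function.Periodic (fun t : ℝ => |h t - 1| + |deriv h t|) (2 * π) := by
      intro t
      simp only [hper t, hdper t]
    exact (hp.compact_of_continuous (by positivity) (by fun_prop)).bddAbove
  have hle : ∀ t, |h t - 1| + |deriv h t| ≤ ε := fun t => le_ciSup hbdd t
  let c : ℝ → EuclideanSpace ℝ (Fin 2) := fun t => !₂[Real.cos t, Real.sin t]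
  have hcc : Continuous c := by
    refine (PiLp.continuous_toLp 2 _).comp ?_
    refine continuous_pi fun i => ?_
    fin_cases i <;> simp <;> fun_prop
  have hγe : γ = fun t => !₂[h t * Real.cos t - deriv h t * Real.sin t,
      h t * Real.sin t + deriv h t * Real.cos t] := by
    funext t
    ext i
    rw [hγ t]
  have hγc : Continuous γ := by
    rw [hγe]
    refine (PiLp.continuous_toLp 2 _).comp ?_
    refine continuous_pi fun i => ?_
    fin_cases i <;> simp <;> fun_prop
  have hclose : ∀ t, ‖γ t - c t‖ ≤ ε := by
    intro t
    refine le_trans ?_ (hle t)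
    rw [EuclideanSpace.norm_eq]
    refine Real.sqrt_le_iff.2 ⟨by positivity, ?_⟩
    simp only [Fin.sum_univ_two, Real.norm_eq_abs, sq_abs, hγe, c]
    simp
    have h1 := abs_nonneg (h t - 1)
    have h2 := abs_nonneg (deriv h t)
    have h3 := sq_abs (h t - 1)
    have h4 := sq_abs (deriv h t)
    have h5 := Real.sin_sq_add_cos_sq t
    have : (h t * Real.cos t - deriv h t * Real.sin t - Real.cos t) ^ 2
        + (h t * Real.sin t + deriv h t * Real.cos t - Real.sin t) ^ 2
        = (h t - 1) ^ 2 + (deriv h t) ^ 2 := by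
      linear_combination ((h t - 1) ^ 2 + (deriv h t) ^ 2) * h5
    rw [this]
    nlinarith [mul_nonneg h1 h2]
  let g : ℝ → ℝ := fun u => √(2 - 2 * Real.cos u)
  have hgp : Function.Periodic g (2 * π) := by
    intro u
    simp only [g, Real.cos_add_two_pi]
  have hcg : ∀ t s, ‖c t - c s‖ = g (t - s) := by
    intro t s
    rw [EuclideanSpace.norm_eq]
    simp only [Fin.sum_univ_two, Real.norm_eq_abs, sq_abs, c, g]
    congr 1
    simp
    rw [Real.cos_sub]
    linear_combination Real.sin_sq_add_cos_sq t + Real.sin_sq_add_cos_sq s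
  have hG : ∀ t, ∫ s in (0 : ℝ)..(2 * π), ‖c t - c s‖ = ∫ u in (0 : ℝ)..(2 * π), g u := by
    intro t
    simp only [hcg]
    rw [intervalIntegral.integral_comp_sub_left (fun u => g u) t]
    have := hgp.intervalIntegral_add_eq (t - 2 * π) 0
    simpa using this
  have hdiff : ∀ t s, |‖γ t - γ s‖ - ‖c t - c s‖| ≤ 2 * ε := by
    intro t s
    calc |‖γ t - γ s‖ - ‖c t - c s‖| ≤ ‖(γ t - γ s) - (c t - c s)‖ := abs_norm_sub_norm_le _ _
      _ = ‖(γ t - c t) - (γ s - c s)‖ := by congr 1; abel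
      _ ≤ ‖γ t - c t‖ + ‖γ s - c s‖ := norm_sub_le _ _
      _ ≤ 2 * ε := by linarith [hclose t, hclose s]
  have hi1 : ∀ t, IntervalIntegrable (fun s => ‖γ t - γ s‖) MeasureTheory.volume 0 (2 * π) :=
    fun t => Continuous.intervalIntegrable (by fun_prop) _ _
  have hi2 : ∀ t, IntervalIntegrable (fun s => ‖c t - c s‖) MeasureTheory.volume 0 (2 * π) :=
    fun t => Continuous.intervalIntegrable (by fun_prop) _ _
  set C := (1 / (2 * π)) * ∫ u in (0 : ℝ)..(2 * π), g u with hC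
  have key : ∀ t, |F t - C| ≤ 2 * ε := by
    intro t
    rw [hF t, hC, ← hG t, ← mul_sub, ← intervalIntegral.integral_sub (hi1 t) (hi2 t), abs_mul]
    have := intervalIntegral.norm_integral_le_of_norm_le_const (a := 0) (b := 2 * π)
      (f := fun s => ‖γ t - γ s‖ - ‖c t - c s‖) (C := 2 * ε) (fun s _ => hdiff t s)
    rw [Real.norm_eq_abs, sub_zero, abs_of_pos Real.two_pi_pos] at this
    rw [abs_of_pos (by positivity), one_div, inv_mul_le_iff₀ Real.two_pi_pos]
    linarith
  have hs : (⨆ t, F t) ≤ C + 2 * ε := ciSup_le fun t => by linarith [(abs_le.1 (key t)).2]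
  have hinf : C - 2 * ε ≤ ⨅ t, F t := le_ciInf fun t => by linarith [(abs_le.1 (key t)).1]
  linarith
end
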